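/- arXiv:1304.1317 — 3 statements merged into one kernel-verified Lean document; each statement's English description precedes it below -/
import Mathlib

section
/- Let γ ∈ [1/2, 1) and let η : ℝ → ℂ be a Schwartz function. There is a constant C, depending only on γ and η, such that for all x ∈ ℝ with x ≠ 0, all t ∈ ℝ and all N ≥ 1, the (absolutely convergent) integral satisfies |∫_ℝ η(ξ/N) e^{i(xξ − tξ²)} |ξ|^{−γ} dξ| ≤ C |x|^{γ−1}. -/
open MeasureTheory Real Filter
open scoped ENNReal

noncomputable section

/-- Fourier transform with the convention `f̂ ξ = ∫ f z e^{-i z·ξ} dz`. -/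
def FT (f : ℝ × ℝ → ℂ) (ξ : ℝ × ℝ) : ℂ :=
  ∫ z : ℝ × ℝ, Complex.exp (-(Complex.I * ((z.1 * ξ.1 + z.2 * ξ.2 : ℝ) : ℂ))) * f z

/-- The Bukhgeim phase `φ_{k,x}(z) = (k/4)((z₁-x₁)² - (z₂-x₂)²)`. -/
def phase (k : ℝ) (x z : ℝ × ℝ) : ℝ :=
  k / 4 * ((z.1 - x.1) ^ 2 - (z.2 - x.2) ^ 2)

/-- Squared weighted (homogeneous Sobolev-type) norm `∫ |ξ|^{2s} |g ξ|² dξ`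
on the Fourier side. -/
def wNormSq (s : ℝ) (g : ℝ × ℝ → ℂ) : ℝ≥0∞ :=
  ∫⁻ ξ : ℝ × ℝ, ENNReal.ofReal ((ξ.1 ^ 2 + ξ.2 ^ 2) ^ s) * (‖g ξ‖₊ : ℝ≥0∞) ^ 2

/-- Squared inhomogeneous Sobolev norm `∫ (1+|ξ|²)^s |g ξ|² dξ` on the Fourier side. -/
def sobNormSq (s : ℝ) (g : ℝ × ℝ → ℂ) : ℝ≥0∞ :=
  ∫⁻ ξ : ℝ × ℝ, ENNReal.ofReal ((1 + ξ.1 ^ 2 + ξ.2 ^ 2) ^ s) * (‖g ξ‖₊ : ℝ≥0∞) ^ 2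

/-- `Fhat` is the Fourier transform of the (square-integrable) function `F`, in the
distributional sense given by the multiplication formula against Schwartz functions. -/
def IsFT (F Fhat : ℝ × ℝ → ℂ) : Prop :=
  ∀ ψ : SchwartzMap (ℝ × ℝ) ℂ,
    ∫ z : ℝ × ℝ, F z * FT (fun w => ψ w) z = ∫ ξ : ℝ × ℝ, Fhat ξ * ψ ξ

/-- The modulation operator `M^{εk}F = χ_Q e^{iε φ_{k,x}} F`. -/
def Mop (Q : Set (ℝ × ℝ)) (ε k : ℝ) (x : ℝ × ℝ) (F : ℝ × ℝ → ℂ) : ℝ × ℝ → ℂ :=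
  Q.indicator fun z => Complex.exp (Complex.I * ((ε * phase k x z : ℝ) : ℂ)) * F z

/-- The Cauchy transform `∂_z^{-1} g (z) = (1/π) ∫ g(w) / ((z₁-w₁) - i(z₂-w₂)) dw`. -/
def CauchyZ (g : ℝ × ℝ → ℂ) (z : ℝ × ℝ) : ℂ :=
  (Real.pi : ℂ)⁻¹ *
    ∫ w : ℝ × ℝ, g w / (((z.1 - w.1 : ℝ) : ℂ) - Complex.I * ((z.2 - w.2 : ℝ) : ℂ))

/-- Euclidean ball in `ℝ × ℝ`. -/
def EBall (x : ℝ × ℝ) (r : ℝ) : Set (ℝ × ℝ) :=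
  {y | (y.1 - x.1) ^ 2 + (y.2 - x.2) ^ 2 < r ^ 2}

/-- The Bukhgeim main term `T^k_1[V](x) = (k/(4π)) ∫ e^{iφ_{k,x}(z)} V(z) dz`. -/
def TT (V : ℝ × ℝ → ℂ) (k : ℝ) (x : ℝ × ℝ) : ℂ :=
  ((k / (4 * Real.pi) : ℝ) : ℂ) *
    ∫ z : ℝ × ℝ, Complex.exp (Complex.I * ((phase k x z : ℝ) : ℂ)) * V z



/-- The oscillating factor. -/
def osc (x t v : ℝ) : ℂ := Complex.exp (Complex.I * ((x * v - t * v ^ 2 : ℝ) : ℂ))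

lemma ii_ofReal {f : ℝ → ℝ} {a b : ℝ} (h : IntervalIntegrable f volume a b) :
    IntervalIntegrable (fun v => ((f v : ℝ) : ℂ)) volume a b :=
  ⟨h.1.ofReal, h.2.ofReal⟩

lemma norm_osc (x t v : ℝ) : ‖osc x t v‖ = 1 := by
  unfold osc; rw [mul_comm]; exact Complex.norm_exp_ofReal_mul_I _

lemma continuous_osc (x t : ℝ) : Continuous (osc x t) := by
  unfold osc; fun_prop

lemma hasDerivAt_osc (x t v : ℝ) :
    HasDerivAt (osc x t) (osc x t v * (Complex.I * ((x - 2 * t * v : ℝ) : ℂ))) v := by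
  have h : HasDerivAt (fun v : ℝ => x * v - t * v ^ 2) (x - 2 * t * v) v := by
    have := ((hasDerivAt_id v).const_mul x).sub (((hasDerivAt_id v).pow 2).const_mul t)
    refine this.congr_deriv ?_
    simp; ring
  exact ((h.ofReal_comp).const_mul Complex.I).cexp

lemma osc_first (x t a b l : ℝ) (hab : a ≤ b) (hl : 0 < l)
    (h : ∀ v ∈ Set.Icc a b, l ≤ |x - 2 * t * v|) :
    ‖∫ v in a..b, osc x t v‖ ≤ 4 / l := by
  have hu : Set.uIcc a b = Set.Icc a b := Set.uIcc_of_le hab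
  have hne : ∀ v ∈ Set.Icc a b, x - 2 * t * v ≠ 0 := fun v hv => by
    have := h v hv
    intro h0; rw [h0] at this; simp at this; linarith
  have hd : ∀ v ∈ Set.Icc a b, HasDerivAt (fun v : ℝ => (x - 2 * t * v)⁻¹)
      (2 * t / (x - 2 * t * v) ^ 2) v := fun v hv => by
    have h1 : HasDerivAt (fun v : ℝ => x - 2 * t * v) (-(2 * t)) v := by
      have := ((hasDerivAt_id v).const_mul (2 * t)).const_sub x
      simpa using this
    exact (h1.fun_inv (hne v hv)).congr_deriv (by rw [neg_neg])
  have hinv : ∀ v ∈ Set.Icc a b, |(x - 2 * t * v)⁻¹| ≤ 1 / l := fun v hv => by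
    rw [abs_inv, one_div]; exact inv_anti₀ hl (h v hv)
  have hq : ContinuousOn (fun v : ℝ => 2 * t / (x - 2 * t * v) ^ 2) (Set.uIcc a b) := by
    rw [hu]
    exact ContinuousOn.div (by fun_prop) (by fun_prop) fun v hv => pow_ne_zero 2 (hne v hv)
  have hqi := hq.intervalIntegrable (μ := volume)
  have hftc : ∫ v in a..b, 2 * t / (x - 2 * t * v) ^ 2
      = (x - 2 * t * b)⁻¹ - (x - 2 * t * a)⁻¹ :=
    intervalIntegral.integral_eq_sub_of_hasDerivAt (fun v hv => hd v (hu ▸ hv)) hqi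
  have ha := hinv a ⟨le_rfl, hab⟩
  have hb := hinv b ⟨hab, le_rfl⟩
  -- the integration by parts
  have hI : ∫ v in a..b, ((-Complex.I) * (((x - 2 * t * v)⁻¹ : ℝ) : ℂ)) *
        (osc x t v * (Complex.I * ((x - 2 * t * v : ℝ) : ℂ)))
      = ((-Complex.I) * (((x - 2 * t * b)⁻¹ : ℝ) : ℂ)) * osc x t b
        - ((-Complex.I) * (((x - 2 * t * a)⁻¹ : ℝ) : ℂ)) * osc x t a
        - ∫ v in a..b, ((-Complex.I) * ((2 * t / (x - 2 * t * v) ^ 2 : ℝ) : ℂ)) * osc x t v := by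
    refine intervalIntegral.integral_mul_deriv_eq_deriv_mul
      (u := fun v : ℝ => (-Complex.I) * (((x - 2 * t * v)⁻¹ : ℝ) : ℂ)) ?_ ?_ ?_ ?_
    · intro v hv
      exact ((hd v (hu ▸ hv)).ofReal_comp).const_mul _
    · intro v hv
      exact hasDerivAt_osc x t v
    · exact (ii_ofReal hqi).const_mul _
    · apply Continuous.intervalIntegrable
      have := continuous_osc x t
      fun_prop
  have hL : ∫ v in a..b, osc x t v = ∫ v in a..b, ((-Complex.I) * (((x - 2 * t * v)⁻¹ : ℝ) : ℂ)) *
        (osc x t v * (Complex.I * ((x - 2 * t * v : ℝ) : ℂ))) := by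
    refine intervalIntegral.integral_congr fun v hv => ?_
    have h0 : ((x - 2 * t * v : ℝ) : ℂ) ≠ 0 := by
      exact_mod_cast hne v (hu ▸ hv)
    simp only [Complex.ofReal_inv]
    field_simp
    rw [Complex.I_sq]; ring
  have hR : ‖∫ v in a..b, ((-Complex.I) * ((2 * t / (x - 2 * t * v) ^ 2 : ℝ) : ℂ)) * osc x t v‖
      ≤ 2 / l := by
    calc _ ≤ ∫ v in a..b, ‖((-Complex.I) * ((2 * t / (x - 2 * t * v) ^ 2 : ℝ) : ℂ)) * osc x t v‖ :=
          intervalIntegral.norm_integral_le_integral_norm hab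
      _ = ∫ v in a..b, SignType.sign t * (2 * t / (x - 2 * t * v) ^ 2) := by
          refine intervalIntegral.integral_congr fun v hv => ?_
          simp only [norm_mul, norm_osc, norm_neg, Complex.norm_I, Complex.norm_real, mul_one,
            one_mul, norm_div, Real.norm_eq_abs, norm_pow, sq_abs]
          have hsg : |2 * t| = SignType.sign t * t * 2 := by
            rw [sign_mul_self, abs_mul, abs_two, mul_comm]
          rw [← abs_mul, hsg]
          ring
      _ = SignType.sign t * ((x - 2 * t * b)⁻¹ - (x - 2 * t * a)⁻¹) := by
          rw [intervalIntegral.integral_const_mul, hftc]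
      _ ≤ |(SignType.sign t : ℝ) * ((x - 2 * t * b)⁻¹ - (x - 2 * t * a)⁻¹)| := le_abs_self _
      _ ≤ 1 * (1 / l + 1 / l) := by
          rw [abs_mul]
          gcongr
          · rcases lt_trichotomy t 0 with h | h | h <;> simp [h]
          · exact (abs_sub _ _).trans (add_le_add hb ha)
      _ = 2 / l := by ring
  rw [hL, hI]
  have e1 : ∀ v, ‖((-Complex.I) * (((x - 2 * t * v)⁻¹ : ℝ) : ℂ)) * osc x t v‖
      = |(x - 2 * t * v)⁻¹| := fun v => by
    rw [norm_mul, norm_osc, norm_mul, Complex.norm_real]; simp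
  refine (norm_sub_le _ _).trans ((add_le_add (norm_sub_le _ _) hR).trans ?_)
  rw [e1, e1]
  have : 4 / l = 1 / l + 1 / l + 2 / l := by ring
  linarith

lemma split3 (f : ℝ → ℂ) (a b p q K1 K2 K3 : ℝ) (hab : a ≤ b)
    (hf : ∀ u v, a ≤ u → u ≤ v → v ≤ b → IntervalIntegrable f volume u v)
    (h1 : 0 ≤ K1) (h2 : 0 ≤ K2) (h3 : 0 ≤ K3)
    (H1 : ∀ u v, a ≤ u → u ≤ v → v ≤ b → v ≤ p → ‖∫ s in u..v, f s‖ ≤ K1)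
    (H2 : ∀ u v, a ≤ u → u ≤ v → v ≤ b → p ≤ u → v ≤ q → ‖∫ s in u..v, f s‖ ≤ K2)
    (H3 : ∀ u v, a ≤ u → u ≤ v → v ≤ b → q ≤ u → ‖∫ s in u..v, f s‖ ≤ K3) :
    ‖∫ s in a..b, f s‖ ≤ K1 + K2 + K3 := by
  have two : ∀ c d, a ≤ c → c ≤ d → d ≤ b → p ≤ c → ‖∫ s in c..d, f s‖ ≤ K2 + K3 := by
    intro c d hac hcd hdb hp
    rcases le_total d q with h | h
    · linarith [H2 c d hac hcd hdb hp h]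
    rcases le_total q c with h' | h'
    · linarith [H3 c d hac hcd hdb h']
    · rw [← intervalIntegral.integral_add_adjacent_intervals (hf c q hac h' (by linarith))
        (hf q d (by linarith) h hdb)]
      exact (norm_add_le _ _).trans (add_le_add (H2 _ _ hac h' (by linarith) hp le_rfl)
        (H3 _ _ (by linarith) h hdb le_rfl))
  rcases le_total b p with h | h
  · linarith [H1 a b le_rfl hab le_rfl h]
  rcases le_total p a with h' | h'
  · linarith [two a b le_rfl hab le_rfl h']
  · rw [← intervalIntegral.integral_add_adjacent_intervals (hf a p le_rfl h' h)
        (hf p b h' h le_rfl), add_assoc]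
    exact (norm_add_le _ _).trans (add_le_add (H1 _ _ le_rfl h' h le_rfl)
        (two _ _ h' h le_rfl le_rfl))

lemma osc_second (x t a b : ℝ) (hab : a ≤ b) (ht : t ≠ 0) :
    ‖∫ v in a..b, osc x t v‖ ≤ 6 / √|t| := by
  have htp : 0 < |t| := abs_pos.mpr ht
  set s := √|t| with hs
  have hsp : 0 < s := Real.sqrt_pos.mpr htp
  have hss : |t| = s * s := (Real.mul_self_sqrt htp.le).symm
  have hphi : ∀ v, |x - 2 * t * v| = 2 * (s * s) * |v - x / (2 * t)| := fun v => by
    rw [← hss, ← abs_two, ← abs_mul, ← abs_mul, ← abs_neg]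
    congr 1; simp only [abs_two]; field_simp; ring
  have key : ∀ v, 1 / s ≤ |v - x / (2 * t)| → 2 * s ≤ |x - 2 * t * v| := fun v hv => by
    rw [hphi]
    calc 2 * s = 2 * (s * s) * (1 / s) := by field_simp
      _ ≤ _ := by gcongr
  have := split3 (osc x t) a b (x / (2 * t) - 1 / s) (x / (2 * t) + 1 / s)
    (4 / (2 * s)) (2 / s) (4 / (2 * s)) hab
    (fun u v _ _ _ => (continuous_osc x t).intervalIntegrable _ _)
    (by positivity) (by positivity) (by positivity) ?_ ?_ ?_
  · refine this.trans (le_of_eq ?_); field_simp; norm_num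
  · intro u v _ huv _ hv
    refine osc_first x t u v _ huv (by positivity) fun w hw => key w ?_
    rw [abs_sub_comm]; refine le_trans ?_ (le_abs_self _); linarith [hw.2]
  · intro u v _ huv _ hu hv
    have := intervalIntegral.norm_integral_le_of_norm_le_const (a := u) (b := v)
      (f := osc x t) (C := 1) (fun w _ => (norm_osc x t w).le)
    rw [abs_of_nonneg (by linarith)] at this
    have e : 2 / s = 1 / s + 1 / s := by ring
    linarith
  · intro u v _ huv _ hv
    refine osc_first x t u v _ huv (by positivity) fun w hw => key w ?_
    refine le_trans ?_ (le_abs_self _); linarith [hw.1]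

lemma osc_weight (γ x t a b K : ℝ) (hγ : 0 < γ) (ha : 0 < a) (hab : a ≤ b)
    (hK : ∀ c ∈ Set.Icc a b, ‖∫ v in a..c, osc x t v‖ ≤ K) :
    ‖∫ v in a..b, osc x t v * ((v ^ (-γ) : ℝ) : ℂ)‖ ≤ K * a ^ (-γ) := by
  have hu : Set.uIcc a b = Set.Icc a b := Set.uIcc_of_le hab
  have hpos : ∀ v ∈ Set.uIcc a b, 0 < v := fun v hv => by rw [hu] at hv; linarith [hv.1]
  have hd : ∀ v ∈ Set.uIcc a b, HasDerivAt (fun v : ℝ => v ^ (-γ)) (-γ * v ^ (-γ - 1)) v :=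
    fun v hv => Real.hasDerivAt_rpow_const (Or.inl (hpos v hv).ne')
  have hdi : IntervalIntegrable (fun v : ℝ => -γ * v ^ (-γ - 1)) volume a b := by
    apply ContinuousOn.intervalIntegrable
    exact continuousOn_const.mul
      (continuousOn_id.rpow_const fun v hv => Or.inl (hpos v hv).ne')
  have hftc := intervalIntegral.integral_eq_sub_of_hasDerivAt hd hdi
  have hI : ∫ v in a..b, ((v ^ (-γ) : ℝ) : ℂ) * osc x t v
      = ((b ^ (-γ) : ℝ) : ℂ) * (∫ v in a..b, osc x t v)
        - ((a ^ (-γ) : ℝ) : ℂ) * (∫ v in a..a, osc x t v)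
        - ∫ v in a..b, ((-γ * v ^ (-γ - 1) : ℝ) : ℂ) * (∫ w in a..v, osc x t w) := by
    refine intervalIntegral.integral_mul_deriv_eq_deriv_mul
      (u := fun v : ℝ => ((v ^ (-γ) : ℝ) : ℂ)) (v := fun v => ∫ w in a..v, osc x t w) ?_ ?_ ?_ ?_
    · intro v hv
      exact (hd v hv).ofReal_comp
    · intro v hv
      exact (continuous_osc x t).integral_hasStrictDerivAt a v |>.hasDerivAt
    · exact ii_ofReal hdi
    · exact (continuous_osc x t).intervalIntegrable _ _
  simp_rw [mul_comm (osc x t _)]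
  rw [hI, intervalIntegral.integral_same, mul_zero, sub_zero]
  have hR : ‖∫ v in a..b, ((-γ * v ^ (-γ - 1) : ℝ) : ℂ) * (∫ w in a..v, osc x t w)‖
      ≤ K * (a ^ (-γ) - b ^ (-γ)) := by
    calc _ ≤ ∫ v in a..b, (-K) * (-γ * v ^ (-γ - 1)) := by
          refine intervalIntegral.norm_integral_le_of_norm_le hab ?_ (hdi.const_mul _)
          refine Eventually.of_forall fun v hv => ?_
          have hv0 : 0 < v := ha.trans hv.1
          have := Real.rpow_pos_of_pos hv0 (-γ - 1)
          rw [norm_mul, Complex.norm_real, Real.norm_eq_abs, neg_mul, abs_neg,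
            abs_of_pos (by positivity)]
          have := hK v ⟨hv.1.le, hv.2⟩
          calc _ ≤ γ * v ^ (-γ - 1) * K := by gcongr
            _ = _ := by ring
      _ = _ := by rw [intervalIntegral.integral_const_mul, hftc]; ring
  have hbp : 0 < b ^ (-γ) := Real.rpow_pos_of_pos (by linarith) _
  calc _ ≤ ‖((b ^ (-γ) : ℝ) : ℂ) * (∫ v in a..b, osc x t v)‖ + K * (a ^ (-γ) - b ^ (-γ)) :=
        (norm_sub_le _ _).trans (add_le_add le_rfl hR)
    _ ≤ b ^ (-γ) * K + K * (a ^ (-γ) - b ^ (-γ)) := by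
        rw [norm_mul, Complex.norm_real, Real.norm_eq_abs, abs_of_pos hbp]
        have := hK b ⟨hab, le_rfl⟩
        gcongr
    _ = _ := by ring

lemma osc_far (γ x t a b : ℝ) (hγ : 1 / 2 ≤ γ) (hx : x ≠ 0) (ha : |x|⁻¹ ≤ a)
    (hab : a ≤ b) :
    ‖∫ v in a..b, osc x t v * ((v ^ (-γ) : ℝ) : ℂ)‖ ≤ 24 * |x| ^ (γ - 1) := by
  have hX : 0 < |x| := abs_pos.mpr hx
  have hXi : 0 < |x|⁻¹ := inv_pos.mpr hX
  have hγ0 : 0 < γ := by linarith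
  have hP : 0 < |x| ^ (γ - 1) := Real.rpow_pos_of_pos hX _
  -- first-derivative regime
  have first : ∀ (l u v : ℝ), 0 < l → |x|⁻¹ ≤ u → u ≤ v →
      (∀ w ∈ Set.Icc u v, l * |x| ≤ |x - 2 * t * w|) →
      ‖∫ v in u..v, osc x t v * ((v ^ (-γ) : ℝ) : ℂ)‖ ≤ 4 / l * |x| ^ (γ - 1) := by
    intro l u v hl hu huv h
    have := osc_weight γ x t u v (4 / (l * |x|)) hγ0 (by linarith) huv fun c hc =>
      osc_first x t u c (l * |x|) hc.1 (by positivity) fun w hw => h w ⟨hw.1, hw.2.trans hc.2⟩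
    refine this.trans ?_
    have e : u ^ (-γ) ≤ |x| ^ γ := by
      rw [show |x| ^ γ = (|x|⁻¹) ^ (-γ) by rw [Real.inv_rpow hX.le, Real.rpow_neg hX.le, inv_inv]]
      exact Real.rpow_le_rpow_of_nonpos hXi hu (by linarith)
    calc _ ≤ 4 / (l * |x|) * |x| ^ γ := by gcongr
      _ = _ := by rw [Real.rpow_sub_one hX.ne']; field_simp
  by_cases ht : t = 0
  · refine (first 1 a b one_pos ha hab ?_).trans ?_
    · intro w _; simp [ht]
    · gcongr; norm_num
  have htp : 0 < |t| := abs_pos.mpr ht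
  have hlow : ∀ w, 0 ≤ w → |x| - 2 * |t| * w ≤ |x - 2 * t * w| ∧
      2 * |t| * w - |x| ≤ |x - 2 * t * w| := fun w hw => by
    have e : |2 * t * w| = 2 * |t| * w := by rw [abs_mul, abs_mul, abs_two, abs_of_nonneg hw]
    rw [← e]
    exact ⟨abs_sub_abs_le_abs_sub _ _, by rw [abs_sub_comm]; exact abs_sub_abs_le_abs_sub _ _⟩
  have := split3 (fun v => osc x t v * ((v ^ (-γ) : ℝ) : ℂ)) a b (|x| / (4 * |t|)) (|x| / |t|)
    (4 / (1 / 2) * |x| ^ (γ - 1)) (12 * |x| ^ (γ - 1)) (4 / 1 * |x| ^ (γ - 1)) hab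
    ?_ (by positivity) (by positivity) (by positivity) ?_ ?_ ?_
  · refine this.trans (le_of_eq ?_); ring
  · intro u v hu huv hv
    apply ContinuousOn.intervalIntegrable
    refine (continuous_osc x t).continuousOn.mul (Complex.continuous_ofReal.comp_continuousOn ?_)
    refine continuousOn_id.rpow_const fun w hw => Or.inl ?_
    rw [Set.uIcc_of_le huv] at hw
    have : 0 < w := by linarith [hw.1]
    exact this.ne'
  · intro u v hu huv hv hvp
    refine first _ u v (by norm_num) (by linarith) huv fun w hw => ?_
    refine le_trans ?_ (hlow w (by linarith [hw.1])).1
    have : w ≤ |x| / (4 * |t|) := hw.2.trans hvp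
    rw [le_div_iff₀ (by positivity)] at this
    linarith
  · intro u v hu huv hv hpu hvq
    have hu0 : 0 < u := by linarith
    refine (osc_weight γ x t u v (6 / √|t|) hγ0 hu0 huv fun c hc =>
      osc_second x t u c hc.1 ht).trans ?_
    have hs : 0 < √|t| := Real.sqrt_pos.mpr htp
    have e0 : u ^ (-γ) = u ^ (-(1/2) : ℝ) * u ^ (-(γ - 1/2)) := by
      rw [← Real.rpow_add hu0]; congr 1; ring
    have e1 : u ^ (-(1/2) : ℝ) ≤ 2 * √|t| * |x| ^ (-(1/2) : ℝ) := by
      refine (Real.rpow_le_rpow_of_nonpos (by positivity) hpu (by norm_num)).trans (le_of_eq ?_)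
      rw [Real.div_rpow hX.le (by positivity), Real.rpow_neg (by positivity : 0 ≤ 4 * |t|),
        ← Real.sqrt_eq_rpow, Real.sqrt_mul (by norm_num),
        show (4 : ℝ) = 2 ^ 2 by norm_num, Real.sqrt_sq (by norm_num)]
      rw [div_inv_eq_mul]; ring
    have e2 : u ^ (-(γ - 1/2)) ≤ |x| ^ (γ - 1/2) := by
      rw [show |x| ^ (γ - 1/2) = (|x|⁻¹) ^ (-(γ - 1/2)) by
        rw [Real.inv_rpow hX.le, Real.rpow_neg hX.le, inv_inv]]
      exact Real.rpow_le_rpow_of_nonpos hXi (by linarith) (by linarith)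
    calc 6 / √|t| * u ^ (-γ)
        ≤ 6 / √|t| * ((2 * √|t| * |x| ^ (-(1/2) : ℝ)) * |x| ^ (γ - 1/2)) := by
          rw [e0]; gcongr
      _ = 12 * (|x| ^ (-(1/2) : ℝ) * |x| ^ (γ - 1/2)) := by field_simp; norm_num
      _ = 12 * |x| ^ (γ - 1) := by
          rw [← Real.rpow_add hX]; congr 2; ring
  · intro u v hu huv hv hqu
    refine first _ u v (by norm_num) (by linarith) huv fun w hw => ?_
    refine le_trans ?_ (hlow w (by linarith [hw.1])).2
    have : |x| / |t| ≤ w := hqu.trans hw.1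
    rw [div_le_iff₀ (by positivity)] at this
    linarith

lemma ii_near (γ x t u v : ℝ) (hγ' : γ < 1) :
    IntervalIntegrable (fun v => osc x t v * ((v ^ (-γ) : ℝ) : ℂ)) volume u v := by
  have h := (intervalIntegral.intervalIntegrable_rpow' (a := u) (b := v) (r := -γ) (by linarith))
  exact (ii_ofReal h).continuousOn_mul (continuous_osc x t).continuousOn

lemma osc_prim (γ x t u : ℝ) (hγ : 1 / 2 ≤ γ) (hγ' : γ < 1) (hx : x ≠ 0) (hu : 0 ≤ u) :
    ‖∫ v in (0:ℝ)..u, osc x t v * ((v ^ (-γ) : ℝ) : ℂ)‖ ≤ (24 + 1 / (1 - γ)) * |x| ^ (γ - 1) := by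
  have hX : 0 < |x| := abs_pos.mpr hx
  have hXi : 0 < |x|⁻¹ := inv_pos.mpr hX
  have hP : 0 < |x| ^ (γ - 1) := Real.rpow_pos_of_pos hX _
  have hg : 0 < 1 - γ := by linarith
  have near : ∀ u, 0 ≤ u → u ≤ |x|⁻¹ → ‖∫ v in (0:ℝ)..u, osc x t v * ((v ^ (-γ) : ℝ) : ℂ)‖
      ≤ 1 / (1 - γ) * |x| ^ (γ - 1) := by
    intro u hu hux
    calc _ ≤ ∫ v in (0:ℝ)..u, v ^ (-γ) := by
          refine intervalIntegral.norm_integral_le_of_norm_le hu (Eventually.of_forall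
            fun v hv => ?_) (intervalIntegral.intervalIntegrable_rpow' (by linarith))
          rw [norm_mul, norm_osc, one_mul, Complex.norm_real, Real.norm_eq_abs,
            abs_of_nonneg (Real.rpow_nonneg hv.1.le _)]
      _ = u ^ (1 - γ) / (1 - γ) := by
          rw [integral_rpow (Or.inl (by linarith)), show -γ + 1 = 1 - γ by ring,
            Real.zero_rpow hg.ne', sub_zero]
      _ ≤ (|x|⁻¹) ^ (1 - γ) / (1 - γ) := by gcongr
      _ = _ := by
          rw [Real.inv_rpow hX.le, ← Real.rpow_neg hX.le, neg_sub]; ring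
  rcases le_total u |x|⁻¹ with h | h
  · refine (near u hu h).trans ?_
    gcongr; linarith
  · rw [← intervalIntegral.integral_add_adjacent_intervals (ii_near γ x t 0 |x|⁻¹ hγ')
      (ii_near γ x t |x|⁻¹ u hγ')]
    refine (norm_add_le _ _).trans ((add_le_add (near _ hXi.le le_rfl)
      (osc_far γ x t _ u hγ hx le_rfl h)).trans (le_of_eq ?_))
    ring

lemma half_integrable (γ : ℝ) (hγ : 1 / 2 ≤ γ) (hγ' : γ < 1) (η : SchwartzMap ℝ ℂ) (x t N : ℝ)
    (hN : N ≠ 0) :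
    IntegrableOn (fun v : ℝ => η (v / N) * (osc x t v * ((v ^ (-γ) : ℝ) : ℂ))) (Set.Ioi 0) := by
  have hη : Continuous fun v : ℝ => η (v / N) := by
    have := η.continuous; fun_prop
  rw [← Set.Ioc_union_Ioi_eq_Ioi (zero_le_one (α := ℝ))]
  refine IntegrableOn.union ?_ ?_
  · rw [← intervalIntegrable_iff_integrableOn_Ioc_of_le zero_le_one]
    exact (ii_near γ x t 0 1 hγ').continuousOn_mul hη.continuousOn
  · have hi : IntegrableOn (fun v : ℝ => η (v / N)) (Set.Ioi 1) :=
      (η.integrable.comp_div hN).integrableOn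
    refine Integrable.mono hi ?_ ?_
    · refine ContinuousOn.aestronglyMeasurable ?_ measurableSet_Ioi
      refine hη.continuousOn.mul ((continuous_osc x t).continuousOn.mul
        (Complex.continuous_ofReal.comp_continuousOn ?_))
      refine continuousOn_id.rpow_const fun w hw => Or.inl ?_
      have : (1 : ℝ) < w := hw
      exact (by linarith : (0 : ℝ) < w).ne'
    · refine (ae_restrict_iff' measurableSet_Ioi).mpr (Eventually.of_forall fun v hv => ?_)
      have hv1 : (1 : ℝ) < v := hv
      have h0 : 0 ≤ v ^ (-γ) := Real.rpow_nonneg (by linarith) _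
      have h1 : v ^ (-γ) ≤ 1 := Real.rpow_le_one_of_one_le_of_nonpos hv1.le (by linarith)
      rw [norm_mul, norm_mul, norm_osc, one_mul, Complex.norm_real, Real.norm_eq_abs,
        abs_of_nonneg h0]
      exact mul_le_of_le_one_right (norm_nonneg _) h1

lemma half_bound (γ : ℝ) (hγ : 1 / 2 ≤ γ) (hγ' : γ < 1) (η : SchwartzMap ℝ ℂ) (x t N : ℝ)
    (hx : x ≠ 0) (hN : N ≠ 0) :
    ‖∫ v in Set.Ioi (0:ℝ), η (v / N) * (osc x t v * ((v ^ (-γ) : ℝ) : ℂ))‖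
      ≤ (∫ v, ‖deriv η v‖) * ((24 + 1 / (1 - γ)) * |x| ^ (γ - 1)) := by
  set B := (24 + 1 / (1 - γ)) * |x| ^ (γ - 1) with hB
  set g : ℝ → ℂ := fun v => osc x t v * ((v ^ (-γ) : ℝ) : ℂ) with hg
  set G : ℝ → ℂ := fun u => ∫ v in (0:ℝ)..u, g v with hG
  have hGb : ∀ u, 0 ≤ u → ‖G u‖ ≤ B := fun u hu => osc_prim γ x t u hγ hγ' hx hu
  have hGc : Continuous G :=
    intervalIntegral.continuous_primitive (fun a b => ii_near γ x t a b hγ') 0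
  have hηc : Continuous η := η.continuous
  have hdi : Integrable (deriv η) := by
    have := (SchwartzMap.derivCLM ℝ ℂ η).integrable (μ := volume)
    exact this.congr (Eventually.of_forall fun v => SchwartzMap.derivCLM_apply ℝ η v)
  have hu : ∀ v ∈ Set.Ioi (0:ℝ), HasDerivAt (fun v : ℝ => η (v / N)) (N⁻¹ • deriv η (v / N)) v := by
    intro v _
    have h1 : HasDerivAt (fun v : ℝ => v / N) N⁻¹ v := by
      simpa using (hasDerivAt_id v).div_const N
    exact HasDerivAt.scomp v (η.differentiableAt.hasDerivAt (x := v / N)) h1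
  have hv : ∀ v ∈ Set.Ioi (0:ℝ), HasDerivAt G (g v) v := by
    intro v hv
    have hv0 : (0:ℝ) < v := hv
    have hgc : ContinuousOn g (Set.Ioi 0) := by
      refine (continuous_osc x t).continuousOn.mul (Complex.continuous_ofReal.comp_continuousOn ?_)
      exact continuousOn_id.rpow_const fun w hw => Or.inl (ne_of_gt hw)
    exact intervalIntegral.integral_hasDerivAt_right (ii_near γ x t 0 v hγ')
      (hgc.stronglyMeasurableAtFilter isOpen_Ioi v hv) (hgc.continuousAt (isOpen_Ioi.mem_nhds hv))
  have hddi : Integrable (fun v : ℝ => N⁻¹ • deriv η (v / N)) := (hdi.comp_div hN).smul N⁻¹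
  have hle : ∀ v ∈ Set.Ioi (0:ℝ), ‖(N⁻¹ • deriv η (v / N)) * G v‖ ≤ ‖N⁻¹ • deriv η (v / N)‖ * B :=
    fun v hv => by
      rw [norm_mul]
      exact mul_le_mul_of_nonneg_left (hGb v (le_of_lt hv)) (norm_nonneg _)
  have hu'v : IntegrableOn ((fun v : ℝ => N⁻¹ • deriv η (v / N)) * G) (Set.Ioi 0) := by
    refine Integrable.mono' ((hddi.norm.mul_const B).integrableOn (s := Set.Ioi 0))
      (hddi.aestronglyMeasurable.mul hGc.aestronglyMeasurable).restrict ?_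
    exact (ae_restrict_iff' measurableSet_Ioi).mpr (Eventually.of_forall hle)
  have h0 : Tendsto ((fun v : ℝ => η (v / N)) * G) (nhdsWithin 0 (Set.Ioi 0)) (nhds 0) := by
    have hc : Continuous ((fun v : ℝ => η (v / N)) * G) :=
      Continuous.mul (by fun_prop) hGc
    have := hc.tendsto 0
    have e : ((fun v : ℝ => η (v / N)) * G) 0 = 0 := by simp [hG]
    rw [e] at this
    exact this.mono_left nhdsWithin_le_nhds
  have hinf : Tendsto ((fun v : ℝ => η (v / N)) * G) atTop (nhds 0) := by
    have h1 : Tendsto (fun v : ℝ => η (v / N)) atTop (nhds 0) := by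
      refine (SchwartzMap.tendsto_cocompact η).comp ?_
      have h2 : Tendsto (fun v : ℝ => v / N) (cocompact ℝ) (cocompact ℝ) := by
        simpa [div_eq_mul_inv] using
          (Homeomorph.mulRight₀ N⁻¹ (inv_ne_zero hN)).isClosedEmbedding.tendsto_cocompact
      exact h2.mono_left atTop_le_cocompact
    have h3 : Tendsto (fun v : ℝ => ‖η (v / N)‖ * B) atTop (nhds 0) := by
      simpa using h1.norm.mul_const B
    refine squeeze_zero_norm' ?_ h3
    filter_upwards [eventually_ge_atTop 0] with v hv
    simp only [Pi.mul_apply, norm_mul]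
    exact mul_le_mul_of_nonneg_left (hGb v hv) (norm_nonneg _)
  have hmain := integral_Ioi_mul_deriv_eq_deriv_mul hu hv
    (half_integrable γ hγ hγ' η x t N hN) hu'v h0 hinf
  rw [hmain, sub_zero, zero_sub, norm_neg]
  calc _ ≤ ∫ v in Set.Ioi (0:ℝ), ‖N⁻¹ • deriv η (v / N)‖ * B :=
        norm_integral_le_of_norm_le (hddi.norm.mul_const B).integrableOn
          ((ae_restrict_iff' measurableSet_Ioi).mpr (Eventually.of_forall hle))
    _ ≤ ∫ v, ‖N⁻¹ • deriv η (v / N)‖ * B := by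
        refine setIntegral_le_integral (hddi.norm.mul_const B) (Eventually.of_forall fun v => ?_)
        exact mul_nonneg (norm_nonneg _) ((norm_nonneg _).trans (hGb 0 le_rfl))
    _ = _ := by
        rw [integral_mul_const]
        congr 1
        simp_rw [norm_smul]
        rw [integral_const_mul, Measure.integral_comp_div (fun v => ‖deriv η v‖) N, norm_inv,
          Real.norm_eq_abs, smul_eq_mul, inv_mul_cancel_left₀ (abs_ne_zero.mpr hN)]


/-- Lemma 4.3 of the paper, due to Sjölin. For `γ ∈ [1/2, 1)` and a
Schwartz function `η : ℝ → ℂ` there is `C = C(γ, η)` such that for all `x ≠ 0`, all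
`t ∈ ℝ` and all `N ≥ 1`, the integral converges absolutely and
`|∫ η(ξ/N) e^{i(xξ - tξ²)} |ξ|^{-γ} dξ| ≤ C |x|^{γ-1}`. -/
theorem stmt9 (γ : ℝ) (hγ : 1/2 ≤ γ) (hγ' : γ < 1) (η : SchwartzMap ℝ ℂ) :
    ∃ C : ℝ, 0 < C ∧
      ∀ (x t N : ℝ), x ≠ 0 → 1 ≤ N →
        Integrable (fun ξ : ℝ =>
          η (ξ / N) * Complex.exp (Complex.I * ((x * ξ - t * ξ ^ 2 : ℝ) : ℂ)) *
            ((|ξ| ^ (-γ) : ℝ) : ℂ)) volume ∧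
        ‖∫ ξ : ℝ,
            η (ξ / N) * Complex.exp (Complex.I * ((x * ξ - t * ξ ^ 2 : ℝ) : ℂ)) *
              ((|ξ| ^ (-γ) : ℝ) : ℂ)‖ ≤ C * |x| ^ (γ - 1) := by
  have hg : 0 < 1 - γ := by linarith
  have hJ : 0 ≤ ∫ v, ‖deriv η v‖ := integral_nonneg fun v => norm_nonneg _
  refine ⟨2 * ((∫ v, ‖deriv η v‖) * (24 + 1 / (1 - γ))) + 1, by positivity, ?_⟩
  intro x t N hx hN
  have hN0 : N ≠ 0 := by linarith
  set F : ℝ → ℂ := fun ξ : ℝ =>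
          η (ξ / N) * Complex.exp (Complex.I * ((x * ξ - t * ξ ^ 2 : ℝ) : ℂ)) *
            ((|ξ| ^ (-γ) : ℝ) : ℂ) with hF
  have hpos : ∀ v ∈ Set.Ioi (0:ℝ), F v = η (v / N) * (osc x t v * ((v ^ (-γ) : ℝ) : ℂ)) := by
    intro v hv
    simp only [hF, osc]
    rw [abs_of_pos hv, mul_assoc]
  have hneg : ∀ v ∈ Set.Ioi (0:ℝ),
      F (-v) = η (v / (-N)) * (osc (-x) t v * ((v ^ (-γ) : ℝ) : ℂ)) := by
    intro v hv
    simp only [hF, osc]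
    rw [abs_neg, abs_of_pos hv, mul_assoc, neg_div, div_neg, neg_sq, mul_neg, neg_mul]
  have i1 : IntegrableOn F (Set.Ioi 0) :=
    (half_integrable γ hγ hγ' η x t N hN0).congr_fun (fun v hv => (hpos v hv).symm)
      measurableSet_Ioi
  have i2' : IntegrableOn (fun v => F (-v)) (Set.Ioi 0) :=
    (half_integrable γ hγ hγ' η (-x) t (-N) (neg_ne_zero.mpr hN0)).congr_fun
      (fun v hv => (hneg v hv).symm) measurableSet_Ioi
  have i2 : IntegrableOn F (Set.Iic 0) := by
    have := i2'.comp_neg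
    rw [integrableOn_Iic_iff_integrableOn_Iio]
    simpa using this
  have hFi : Integrable F := by
    rw [← integrableOn_univ, ← Set.Iic_union_Ioi (a := (0:ℝ))]
    exact i2.union i1
  refine ⟨hFi, ?_⟩
  have b1 := half_bound γ hγ hγ' η x t N hx hN0
  have b2 := half_bound γ hγ hγ' η (-x) t (-N) (neg_ne_zero.mpr hx) (neg_ne_zero.mpr hN0)
  rw [← setIntegral_congr_fun measurableSet_Ioi hpos] at b1
  rw [← setIntegral_congr_fun measurableSet_Ioi hneg, integral_comp_neg_Ioi, neg_zero, abs_neg] at b2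
  rw [← intervalIntegral.integral_Iic_add_Ioi i2 i1]
  have hP : 0 ≤ |x| ^ (γ - 1) := Real.rpow_nonneg (abs_nonneg _) _
  refine (norm_add_le _ _).trans ((add_le_add b2 b1).trans ?_)
  linarith


end
end

section
/- For every s with 0 < s < 1/2 there exists a compactly supported function V ∈ L¹(ℝ²), real-valued almost everywhere, with ‖V‖_{H^s} < ∞, such that the set of x ∈ ℝ² at which limsup_{k→∞, k∈ℕ} |T^k_1[V](x)| = +∞ has positive Lebesgue measure; in particular, T^k_1[V](x) fails to converge to V(x) on a set of positive Lebesgue measure. -/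
open MeasureTheory Real Filter
open scoped ENNReal

noncomputable section

theorem exists_phi : ∃ φ : ℝ → ℝ, Continuous φ ∧ (∀ u, 0 ≤ φ u) ∧ (∀ u, 1 ≤ |u| → φ u = 0) ∧
    0 < ∫ u, φ u ∧ Integrable φ ∧ ∃ C : ℝ, 0 < C ∧ ∀ μ : ℝ,
      ‖∫ u : ℝ, Complex.exp (Complex.I * ((μ * u : ℝ) : ℂ)) * (φ u : ℂ)‖ ≤ C / (1 + μ ^ 2) := by
  let b : ContDiffBump (0 : ℝ) := ⟨1/2, 1, by norm_num, by norm_num⟩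
  have hc : HasCompactSupport (fun u => ((b u : ℝ) : ℂ)) := by
    have := b.hasCompactSupport
    exact this.comp_left (g := fun r : ℝ => (r : ℂ)) (by simp)
  have hs : ContDiff ℝ (⊤ : ℕ∞) (fun u => ((b u : ℝ) : ℂ)) :=
    Complex.ofRealCLM.contDiff.comp b.contDiff
  let f : SchwartzMap ℝ ℂ := hc.toSchwartzMap hs
  let F := FourierTransform.fourier f
  obtain ⟨C0, hC0, h0⟩ := F.decay 0 0
  obtain ⟨C2, hC2, h2⟩ := F.decay 2 0
  refine ⟨b, b.continuous, fun u => b.nonneg, ?_, b.integral_pos, b.integrable,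
    C0 + C2 * (2 * π) ^ 2, by positivity, ?_⟩
  · intro u hu
    apply b.zero_of_le_dist
    simpa [b, Real.dist_eq] using hu
  · intro μ
    have e : ∫ u : ℝ, Complex.exp (Complex.I * ((μ * u : ℝ) : ℂ)) * ((b u : ℝ) : ℂ)
        = F (-(μ / (2 * π))) := by
      change _ = FourierTransform.fourier f _
      rw [SchwartzMap.fourier_coe, Real.fourier_real_eq_integral_exp_smul]
      congr 1
      ext u
      rw [smul_eq_mul]
      congr 2
      push_cast
      have : (π : ℂ) ≠ 0 := by exact_mod_cast Real.pi_ne_zero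
      field_simp
    rw [e, le_div_iff₀ (by positivity)]
    have a0 := h0 (-(μ / (2 * π)))
    have a2 := h2 (-(μ / (2 * π)))
    simp only [norm_iteratedFDeriv_zero, pow_zero, one_mul] at a0 a2
    have : ‖-(μ / (2 * π))‖ ^ 2 = μ ^ 2 / (2 * π) ^ 2 := by
      rw [norm_neg, Real.norm_eq_abs, sq_abs, div_pow]
    rw [this, div_mul_eq_mul_div, div_le_iff₀ (by positivity)] at a2
    linarith

def Lrot : ℝ × ℝ →ₗ[ℝ] ℝ × ℝ where
  toFun z := (z.1 + z.2, z.1 - z.2)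
  map_add' := by intro x y; ext <;> simp <;> ring
  map_smul' := by intro x y; ext <;> simp <;> ring

theorem det_Lrot : LinearMap.det Lrot = -2 := by
  rw [← LinearMap.det_toMatrix (Module.Basis.finTwoProd ℝ), Matrix.det_fin_two]
  simp [LinearMap.toMatrix_apply, Lrot]
  norm_num

theorem map_Lrot : Measure.map (fun z : ℝ × ℝ => (z.1 + z.2, z.1 - z.2)) volume
    = ENNReal.ofReal (1/2) • (volume : Measure (ℝ × ℝ)) := by
  have := Measure.map_linearMap_addHaar_eq_smul_addHaar (volume : Measure (ℝ × ℝ)) (f := Lrot)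
    (by rw [det_Lrot]; norm_num)
  rw [det_Lrot] at this
  convert! this using 3
  norm_num

theorem emb_rot : MeasurableEmbedding (fun z : ℝ × ℝ => (z.1 + z.2, z.1 - z.2)) := by
  apply Continuous.measurableEmbedding (by fun_prop)
  intro x y h
  simp only [Prod.mk.injEq] at h
  ext <;> linarith [h.1, h.2]

theorem integral_rot (G : ℝ × ℝ → ℂ) :
    ∫ z : ℝ × ℝ, G (z.1 + z.2, z.1 - z.2) = (1/2 : ℝ) * ∫ y, G y := by
  rw [← emb_rot.integral_map (g := G), map_Lrot, integral_smul_measure]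
  rw [ENNReal.toReal_ofReal (by norm_num), Complex.real_smul]

theorem integrable_rot {G : ℝ × ℝ → ℂ} (h : Integrable G) :
    Integrable (fun z : ℝ × ℝ => G (z.1 + z.2, z.1 - z.2)) := by
  rw [← Function.comp_def G, ← emb_rot.integrable_map_iff, map_Lrot]
  exact h.smul_measure (by simp)

theorem lintegral_rot (G : ℝ × ℝ → ℝ≥0∞) :
    ∫⁻ z : ℝ × ℝ, G (z.1 + z.2, z.1 - z.2) = ENNReal.ofReal (1/2) * ∫⁻ y, G y := by
  rw [← emb_rot.lintegral_map, map_Lrot, lintegral_smul_measure, smul_eq_mul]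

def wd (N : ℝ) : ℝ := 1 / (4096 * N)

def gN (φ : ℝ → ℝ) (N u : ℝ) : ℂ := ((φ u * Real.cos (N * u) : ℝ) : ℂ)

def hN (N v : ℝ) : ℂ := (Set.Ioc 0 (wd N)).indicator (fun _ => (1 : ℂ)) v

def VR (φ : ℝ → ℝ) (N A : ℝ) (z : ℝ × ℝ) : ℝ :=
  A * (φ (z.1 + z.2) * Real.cos (N * (z.1 + z.2))) *
    (Set.Ioc 0 (wd N)).indicator (fun _ => (1 : ℝ)) (z.1 - z.2)

def GG (φ : ℝ → ℝ) (N u0 l : ℝ) : ℂ :=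
  ∫ u : ℝ, Complex.exp (Complex.I * ((l * (u - u0) : ℝ) : ℂ)) * gN φ N u

theorem VR_eq (φ : ℝ → ℝ) (N A : ℝ) (z : ℝ × ℝ) :
    ((VR φ N A z : ℝ) : ℂ) = A * (gN φ N (z.1 + z.2) * hN N (z.1 - z.2)) := by
  unfold VR gN hN
  by_cases h : z.1 - z.2 ∈ Set.Ioc 0 (wd N) <;> simp [h]

theorem norm_expI (r : ℝ) : ‖Complex.exp (Complex.I * (r : ℂ))‖ = 1 := by
  rw [mul_comm]; exact Complex.norm_exp_ofReal_mul_I r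

theorem gN_integrable {φ : ℝ → ℝ} (hi : Integrable φ) (N : ℝ) : Integrable (gN φ N) := by
  unfold gN
  apply Integrable.ofReal
  apply hi.mul_bdd (c := 1) (by fun_prop)
  exact Eventually.of_forall fun u => Real.abs_cos_le_one _

theorem hN_integrable (N : ℝ) : Integrable (hN N) := by
  unfold hN
  rw [integrable_indicator_iff measurableSet_Ioc]
  exact integrableOn_const (by simp)

theorem exp_mul_integrable {φ : ℝ → ℝ} (hi : Integrable φ) (l : ℝ) :
    Integrable (fun u : ℝ => Complex.exp (Complex.I * ((l * u : ℝ) : ℂ)) * (φ u : ℂ)) := by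
  apply Integrable.bdd_mul (c := 1) hi.ofReal
  · apply Continuous.aestronglyMeasurable; fun_prop
  · exact Eventually.of_forall fun u => (norm_expI _).le

theorem GG_bound {φ : ℝ → ℝ} (hi : Integrable φ) {C : ℝ}
    (hC : ∀ μ : ℝ, ‖∫ u : ℝ, Complex.exp (Complex.I * ((μ * u : ℝ) : ℂ)) * (φ u : ℂ)‖
      ≤ C / (1 + μ ^ 2)) (N u0 l : ℝ) :
    ‖GG φ N u0 l‖ ≤ C / 2 * ((1 + (l + N) ^ 2)⁻¹ + (1 + (l - N) ^ 2)⁻¹) := by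
  have e : GG φ N u0 l = Complex.exp (Complex.I * ((-(l * u0) : ℝ) : ℂ)) * ((1/2 : ℂ) *
      ((∫ u : ℝ, Complex.exp (Complex.I * (((l + N) * u : ℝ) : ℂ)) * (φ u : ℂ)) +
       ∫ u : ℝ, Complex.exp (Complex.I * (((l - N) * u : ℝ) : ℂ)) * (φ u : ℂ))) := by
    rw [← integral_add (exp_mul_integrable hi _) (exp_mul_integrable hi _), ← integral_const_mul,
      ← integral_const_mul]
    unfold GG gN
    congr 1
    ext u
    push_cast
    rw [Complex.cos]
    have e1 : Complex.exp (Complex.I * (l * (u - u0))) =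
      Complex.exp (Complex.I * -(l * u0)) * Complex.exp (Complex.I * (l * u)) := by
      rw [← Complex.exp_add]; ring_nf
    have e2 : Complex.exp (Complex.I * ((l + N) * u)) =
      Complex.exp (Complex.I * (l * u)) * Complex.exp (N * u * Complex.I) := by
      rw [← Complex.exp_add]; ring_nf
    have e3 : Complex.exp (Complex.I * ((l - N) * u)) =
      Complex.exp (Complex.I * (l * u)) * Complex.exp (-(N * u) * Complex.I) := by
      rw [← Complex.exp_add]; ring_nf
    rw [e1, e2, e3]
    ring
  rw [e, norm_mul, norm_expI, one_mul, norm_mul]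
  have h1 := hC (l + N)
  have h2 := hC (l - N)
  have h3 := norm_add_le
    (∫ u : ℝ, Complex.exp (Complex.I * (((l + N) * u : ℝ) : ℂ)) * (φ u : ℂ))
    (∫ u : ℝ, Complex.exp (Complex.I * (((l - N) * u : ℝ) : ℂ)) * (φ u : ℂ))
  have h4 : ‖(1/2 : ℂ)‖ = 1/2 := by norm_num
  rw [h4]
  rw [div_eq_mul_inv] at h1 h2
  nlinarith

theorem prod_integrable {φ : ℝ → ℝ} (hi : Integrable φ) (N A : ℝ) :
    Integrable (fun y : ℝ × ℝ => (A : ℂ) * (gN φ N y.1 * hN N y.2)) :=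
  ((gN_integrable hi N).mul_prod (hN_integrable N)).const_mul _

theorem VR_integrable {φ : ℝ → ℝ} (hi : Integrable φ) (N A : ℝ) :
    Integrable (fun z => ((VR φ N A z : ℝ) : ℂ)) := by
  simp_rw [VR_eq]
  exact integrable_rot (prod_integrable hi N A)

theorem osc_formula {φ : ℝ → ℝ} (hi : Integrable φ) (N A k : ℝ) (x : ℝ × ℝ) :
    ∫ z : ℝ × ℝ, Complex.exp (Complex.I * ((phase k x z : ℝ) : ℂ)) * ((VR φ N A z : ℝ) : ℂ)
    = ((A / 2 : ℝ) : ℂ) * ∫ v in Set.Ioc 0 (wd N),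
        GG φ N (x.1 + x.2) (k / 4 * (v - (x.1 - x.2))) := by
  let G : ℝ × ℝ → ℂ := fun y =>
    Complex.exp (Complex.I * ((k / 4 * (y.2 - (x.1 - x.2)) * (y.1 - (x.1 + x.2)) : ℝ) : ℂ)) *
      ((A : ℂ) * (gN φ N y.1 * hN N y.2))
  have hG : Integrable G := by
    apply Integrable.bdd_mul (c := 1) (prod_integrable hi N A)
    · apply Continuous.aestronglyMeasurable; fun_prop
    · exact Eventually.of_forall fun u => (norm_expI _).le
  have e1 : ∀ z : ℝ × ℝ, Complex.exp (Complex.I * ((phase k x z : ℝ) : ℂ)) *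
      ((VR φ N A z : ℝ) : ℂ) = G (z.1 + z.2, z.1 - z.2) := by
    intro z
    rw [VR_eq]
    simp only [G]
    congr 4
    unfold phase
    ring
  simp_rw [e1]
  rw [integral_rot, Measure.volume_eq_prod, integral_prod_symm _ (by rwa [← Measure.volume_eq_prod])]
  have e2 : ∀ v : ℝ, ∫ u : ℝ, G (u, v) = (A : ℂ) * ((Set.Ioc 0 (wd N)).indicator
      (fun v => GG φ N (x.1 + x.2) (k / 4 * (v - (x.1 - x.2)))) v) := by
    intro v
    by_cases h : v ∈ Set.Ioc 0 (wd N)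
    · simp only [h, Set.indicator_of_mem, G, GG, hN]
      rw [← integral_const_mul]
      congr 1
      ext u
      ring
    · simp [h, G, hN]
  simp_rw [e2]
  rw [integral_const_mul, integral_indicator measurableSet_Ioc]
  push_cast
  ring

theorem VR_L1 {φ : ℝ → ℝ} (hi : Integrable φ) (hp : ∀ u, 0 ≤ φ u) {N A : ℝ} (hN0 : 0 < N)
    (hA : 0 ≤ A) : ∫ z, ‖((VR φ N A z : ℝ) : ℂ)‖ ≤ (∫ u, φ u) * (A / N) := by
  have e : ∀ z : ℝ × ℝ, ((‖((VR φ N A z : ℝ) : ℂ)‖ : ℝ) : ℂ) =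
     (fun y : ℝ × ℝ => ((A * ‖gN φ N y.1‖ : ℝ) : ℂ) * hN N y.2) (z.1 + z.2, z.1 - z.2) := by
    intro z
    rw [VR_eq, norm_mul, norm_mul]
    by_cases h : z.1 - z.2 ∈ Set.Ioc 0 (wd N) <;> simp [h, hN, abs_of_nonneg hA]
  have h1 : ((∫ z, ‖((VR φ N A z : ℝ) : ℂ)‖ : ℝ) : ℂ) =
      ((1/2 * ((∫ u, A * ‖gN φ N u‖) * wd N) : ℝ) : ℂ) := by
    rw [← integral_complex_ofReal]
    simp_rw [e]
    rw [integral_rot (fun y : ℝ × ℝ => ((A * ‖gN φ N y.1‖ : ℝ) : ℂ) * hN N y.2),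
      Measure.volume_eq_prod, integral_prod_mul (fun u => ((A * ‖gN φ N u‖ : ℝ) : ℂ))]
    have : ∫ v, hN N v = (wd N : ℂ) := by
      unfold hN
      rw [integral_indicator measurableSet_Ioc]
      have : 0 ≤ wd N := by unfold wd; positivity
      simp [this]
    rw [this, integral_complex_ofReal]
    push_cast
    ring
  have h1' := Complex.ofReal_injective h1
  rw [h1', integral_const_mul]
  have h2 : ∫ u, ‖gN φ N u‖ ≤ ∫ u, φ u := by
    apply integral_mono (gN_integrable hi N).norm hi
    intro u
    simp only [gN, Complex.norm_real, norm_mul, Real.norm_eq_abs, abs_of_nonneg (hp u)]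
    exact mul_le_of_le_one_right (hp u) (Real.abs_cos_le_one _)
  have h3 : 0 ≤ ∫ u, ‖gN φ N u‖ := integral_nonneg fun u => norm_nonneg _
  have h4 : wd N ≤ 1 / N := by
    unfold wd
    apply one_div_le_one_div_of_le hN0
    linarith
  have h5 : 0 ≤ wd N := by unfold wd; positivity
  calc 1/2 * (A * (∫ u, ‖gN φ N u‖) * wd N) ≤ A * (∫ u, ‖gN φ N u‖) * wd N := by
        have : 0 ≤ A * (∫ u, ‖gN φ N u‖) * wd N := by positivity
        linarith
    _ ≤ A * (∫ u, φ u) * (1 / N) := by gcongr; exact mul_nonneg hA (h3.trans h2)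
    _ = _ := by ring

theorem TT_L1 (V : ℝ × ℝ → ℂ) (k : ℝ) (hk : 0 ≤ k) (x : ℝ × ℝ) :
    ‖TT V k x‖ ≤ k * ∫ z, ‖V z‖ := by
  unfold TT
  rw [norm_mul]
  have h1 : ‖((k / (4 * Real.pi) : ℝ) : ℂ)‖ ≤ k := by
    rw [Complex.norm_real, Real.norm_of_nonneg (by positivity)]
    apply div_le_self hk
    have := Real.pi_gt_three; linarith
  have h2 := norm_integral_le_integral_norm (μ := volume)
    (fun z => Complex.exp (Complex.I * ((phase k x z : ℝ) : ℂ)) * V z)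
  simp only [norm_mul, norm_expI, one_mul] at h2
  gcongr

theorem int_bound {k : ℝ} (hk : 0 < k) (c : ℝ) :
    Integrable (fun v : ℝ => (1 + (k * v + c) ^ 2)⁻¹) ∧
    ∫ v : ℝ, (1 + (k * v + c) ^ 2)⁻¹ = π / k := by
  constructor
  · exact (integrable_inv_one_add_sq.comp_add_right c).comp_mul_left' hk.ne'
  · have := Measure.integral_comp_mul_left (fun y : ℝ => (1 + (y + c) ^ 2)⁻¹) k
    rw [this, integral_add_right_eq_self (fun y : ℝ => (1 + y ^ 2)⁻¹), integral_univ_inv_one_add_sq,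
      abs_of_pos (by positivity), smul_eq_mul]
    field_simp

theorem TT_upper {φ : ℝ → ℝ} (hi : Integrable φ) {C : ℝ} (hC0 : 0 < C)
    (hC : ∀ μ : ℝ, ‖∫ u : ℝ, Complex.exp (Complex.I * ((μ * u : ℝ) : ℂ)) * (φ u : ℂ)‖
      ≤ C / (1 + μ ^ 2)) {N A : ℝ} (hA : 0 ≤ A) {k : ℝ} (hk : 0 < k) (x : ℝ × ℝ) :
    ‖TT (fun z => ((VR φ N A z : ℝ) : ℂ)) k x‖ ≤ C * A := by
  unfold TT
  rw [osc_formula hi, norm_mul, norm_mul, Complex.norm_real, Complex.norm_real,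
    Real.norm_of_nonneg (by positivity), Real.norm_of_nonneg (by positivity)]
  obtain ⟨i1, j1⟩ := int_bound (k := k / 4) (by positivity) (- (k / 4 * (x.1 - x.2)) + N)
  obtain ⟨i2, j2⟩ := int_bound (k := k / 4) (by positivity) (- (k / 4 * (x.1 - x.2)) - N)
  have h : ‖∫ v in Set.Ioc 0 (wd N), GG φ N (x.1 + x.2) (k / 4 * (v - (x.1 - x.2)))‖ ≤
      C / 2 * (π / (k / 4) + π / (k / 4)) := by
    rw [← j1]
    nth_rewrite 2 [j1]
    rw [← j2, ← integral_add i1 i2, ← integral_const_mul]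
    have hint := (i1.add i2).const_mul (C / 2)
    refine (norm_integral_le_of_norm_le hint.integrableOn (Eventually.of_forall ?_)).trans
      (setIntegral_le_integral hint (Eventually.of_forall ?_))
    · intro v
      refine (GG_bound hi hC _ _ _).trans (le_of_eq ?_)
      simp only [Pi.add_apply]
      ring_nf
    · intro v
      simp only [Pi.add_apply, Pi.zero_apply]
      positivity
  calc _ ≤ k / (4 * π) * (A / 2 * (C / 2 * (π / (k / 4) + π / (k / 4)))) := by gcongr
    _ = C * A / 2 := by field_simp; norm_num
    _ ≤ C * A := by
      have : 0 ≤ C * A := by positivity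
      linarith

theorem GG_approx {φ : ℝ → ℝ} (hi : Integrable φ) (hp : ∀ u, 0 ≤ φ u)
    (hsupp : ∀ u, 1 ≤ |u| → φ u = 0) {C : ℝ}
    (hC : ∀ μ : ℝ, ‖∫ u : ℝ, Complex.exp (Complex.I * ((μ * u : ℝ) : ℂ)) * (φ u : ℂ)‖
      ≤ C / (1 + μ ^ 2)) {N u0 l : ℝ} (hN : C / (1 + (2 * N) ^ 2) ≤ (∫ u, φ u) / 8)
    (hu : |u0| ≤ 1) (hl : |l + N| ≤ 1 / 32) :
    ‖GG φ N u0 l * Complex.exp (Complex.I * ((-(N * u0) : ℝ) : ℂ)) -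
      (((∫ u, φ u) / 2 : ℝ) : ℂ)‖ ≤ (∫ u, φ u) / 8 := by
  have hi1 : Integrable (fun u : ℝ => ((φ u : ℝ) : ℂ)) := hi.ofReal
  have hi2 := exp_mul_integrable hi (-2 * N)
  have hi3 : Integrable (fun u : ℝ => Complex.exp (Complex.I * ((l * (u - u0) : ℝ) : ℂ)) *
      gN φ N u) := by
    apply Integrable.bdd_mul (c := 1) (gN_integrable hi N)
    · apply Continuous.aestronglyMeasurable; fun_prop
    · exact Eventually.of_forall fun u => (norm_expI _).le
  have e : GG φ N u0 l * Complex.exp (Complex.I * ((-(N * u0) : ℝ) : ℂ)) -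
      (((∫ u, φ u) / 2 : ℝ) : ℂ) =
      (1/2 : ℂ) * (∫ u : ℝ, Complex.exp (Complex.I * ((-2 * N * u : ℝ) : ℂ)) * (φ u : ℂ)) +
      ∫ u : ℝ, (Complex.exp (Complex.I * ((l * (u - u0) : ℝ) : ℂ)) * gN φ N u *
        Complex.exp (Complex.I * ((-(N * u0) : ℝ) : ℂ)) - ((1/2 : ℂ) * (φ u : ℂ)) -
        (1/2 : ℂ) * (Complex.exp (Complex.I * ((-2 * N * u : ℝ) : ℂ)) * (φ u : ℂ))) := by
    have hi4 : Integrable (fun u : ℝ => Complex.exp (Complex.I * ((l * (u - u0) : ℝ) : ℂ)) *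
        gN φ N u * Complex.exp (Complex.I * ((-(N * u0) : ℝ) : ℂ)) - ((1/2 : ℂ) * (φ u : ℂ))) :=
      (hi3.mul_const _).sub (hi1.const_mul _)
    rw [integral_sub hi4 (hi2.const_mul _),
      integral_sub (hi3.mul_const _) (hi1.const_mul _), integral_mul_const, integral_const_mul,
      integral_const_mul, integral_complex_ofReal]
    unfold GG
    push_cast
    ring
  rw [e]
  refine (norm_add_le _ _).trans ?_
  have h1 : ‖(1/2 : ℂ) * (∫ u : ℝ, Complex.exp (Complex.I * ((-2 * N * u : ℝ) : ℂ)) *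
      (φ u : ℂ))‖ ≤ (∫ u, φ u) / 16 := by
    rw [norm_mul]
    have := (hC (-2 * N)).trans (le_trans (le_of_eq (by ring_nf)) hN)
    have h4 : ‖(1/2 : ℂ)‖ = 1/2 := by norm_num
    rw [h4]
    linarith
  have h2 : ‖∫ u : ℝ, (Complex.exp (Complex.I * ((l * (u - u0) : ℝ) : ℂ)) * gN φ N u *
        Complex.exp (Complex.I * ((-(N * u0) : ℝ) : ℂ)) - ((1/2 : ℂ) * (φ u : ℂ)) -
        (1/2 : ℂ) * (Complex.exp (Complex.I * ((-2 * N * u : ℝ) : ℂ)) * (φ u : ℂ)))‖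
      ≤ ∫ u, φ u / 16 := by
    apply norm_integral_le_of_norm_le (hi.div_const 16)
    refine Eventually.of_forall fun u => ?_
    by_cases hu1 : 1 ≤ |u|
    · simp [gN, hsupp u hu1]
    push Not at hu1
    have e1 : Complex.exp (Complex.I * ((l * (u - u0) : ℝ) : ℂ)) * gN φ N u *
        Complex.exp (Complex.I * ((-(N * u0) : ℝ) : ℂ)) - ((1/2 : ℂ) * (φ u : ℂ)) -
        (1/2 : ℂ) * (Complex.exp (Complex.I * ((-2 * N * u : ℝ) : ℂ)) * (φ u : ℂ))
        = (1/2 : ℂ) * (φ u : ℂ) * (Complex.exp (Complex.I * (((l + N) * (u - u0) : ℝ) : ℂ)) - 1) *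
          (1 + Complex.exp (Complex.I * ((-2 * N * u : ℝ) : ℂ))) := by
      unfold gN
      push_cast
      rw [Complex.cos]
      have a1 : Complex.exp (Complex.I * ((l + N) * (u - u0))) =
          Complex.exp (Complex.I * (l * (u - u0))) * Complex.exp (N * u * Complex.I) *
          Complex.exp (Complex.I * -(N * u0)) := by
        rw [← Complex.exp_add, ← Complex.exp_add]; ring_nf
      have a2 : Complex.exp (-(N * u) * Complex.I) =
          Complex.exp (Complex.I * (-2 * N * u)) * Complex.exp (N * u * Complex.I) := by
        rw [← Complex.exp_add]; ring_nf
      rw [a1, a2]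
      ring
    rw [e1, norm_mul, norm_mul, norm_mul, Complex.norm_real, Real.norm_of_nonneg (hp u)]
    have b1 : ‖Complex.exp (Complex.I * (((l + N) * (u - u0) : ℝ) : ℂ)) - 1‖ ≤ 1 / 16 := by
      refine (Real.norm_exp_I_mul_ofReal_sub_one_le).trans ?_
      rw [norm_mul, Real.norm_eq_abs, Real.norm_eq_abs]
      have : |u - u0| ≤ 2 := (abs_sub _ _).trans (by linarith)
      calc |l + N| * |u - u0| ≤ 1 / 32 * 2 := by gcongr
        _ = _ := by norm_num
    have b2 : ‖1 + Complex.exp (Complex.I * ((-2 * N * u : ℝ) : ℂ))‖ ≤ 2 := by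
      refine (norm_add_le _ _).trans ?_
      rw [norm_expI, norm_one]; norm_num
    have h4 : ‖(1/2 : ℂ)‖ = 1/2 := by norm_num
    rw [h4]
    have := hp u
    calc _ ≤ 1/2 * φ u * (1/16) * 2 := by gcongr
      _ = _ := by ring
  rw [integral_div] at h2
  linarith

theorem TT_lower {φ : ℝ → ℝ} (hi : Integrable φ) (hp : ∀ u, 0 ≤ φ u)
    (hsupp : ∀ u, 1 ≤ |u| → φ u = 0) {C : ℝ}
    (hC : ∀ μ : ℝ, ‖∫ u : ℝ, Complex.exp (Complex.I * ((μ * u : ℝ) : ℂ)) * (φ u : ℂ)‖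
      ≤ C / (1 + μ ^ 2)) {N : ℝ} (hN : C / (1 + (2 * N) ^ 2) ≤ (∫ u, φ u) / 8) (hN1 : 1 ≤ N)
    {A : ℝ} (hA : 0 ≤ A) {k : ℝ} {x : ℝ × ℝ} (hu : |x.1 + x.2| ≤ 1) (hv1 : 1 / 64 < x.1 - x.2)
    (hv2 : x.1 - x.2 < 1 / 32) (hk : |k * (x.1 - x.2) - 4 * N| ≤ x.1 - x.2) :
    127 * N ≤ k ∧ k ≤ 257 * N ∧
    (∫ u, φ u) / (2048 * π) * A ≤ ‖TT (fun z => ((VR φ N A z : ℝ) : ℂ)) k x‖ := by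
  set v0 := x.1 - x.2 with hv0
  set I0 := ∫ u, φ u with hI0
  have hI : 0 ≤ I0 := integral_nonneg hp
  obtain ⟨hk1, hk2⟩ := abs_le.1 hk
  have hv0p : 0 < v0 := by linarith
  have k1 : 127 * N ≤ k := by
    by_contra hcon
    push Not at hcon
    nlinarith
  have k2 : k ≤ 257 * N := by
    by_contra hcon
    push Not at hcon
    nlinarith
  refine ⟨k1, k2, ?_⟩
  have hw : 0 < wd N := by unfold wd; positivity
  have hwN : wd N * N = 1 / 4096 := by unfold wd; field_simp
  have hint : ‖(∫ v in Set.Ioc 0 (wd N), (GG φ N (x.1 + x.2) (k / 4 * (v - v0)) *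
      Complex.exp (Complex.I * ((-(N * (x.1 + x.2)) : ℝ) : ℂ)) - ((I0 / 2 : ℝ) : ℂ)))‖
        ≤ I0 / 8 * wd N := by
    have := norm_setIntegral_le_of_norm_le_const (μ := volume) (s := Set.Ioc 0 (wd N))
      (f := fun v => (GG φ N (x.1 + x.2) (k / 4 * (v - v0)) *
      Complex.exp (Complex.I * ((-(N * (x.1 + x.2)) : ℝ) : ℂ)) - ((I0 / 2 : ℝ) : ℂ)))
      (C := I0 / 8) (by simp) ?_
    · simpa [hw.le] using this
    · intro v hv
      apply GG_approx hi hp hsupp hC hN hu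
      have e : k / 4 * (v - v0) + N = k * v / 4 - (k * v0 - 4 * N) / 4 := by ring
      have kv : k * v ≤ 257 / 4096 := by
        calc k * v ≤ (257 * N) * wd N := by
              apply mul_le_mul k2 hv.2 hv.1.le; positivity
          _ = 257 * (wd N * N) := by ring
          _ = _ := by rw [hwN]; norm_num
      have kv0 : 0 ≤ k * v := mul_nonneg (by linarith) hv.1.le
      rw [e, abs_le]
      constructor <;> linarith
  have hGc : Continuous (GG φ N (x.1 + x.2)) := by
    unfold GG
    apply continuous_of_dominated (bound := fun u => ‖gN φ N u‖)
    · intro l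
      apply AEStronglyMeasurable.mul _ (gN_integrable hi N).1
      apply Continuous.aestronglyMeasurable; fun_prop
    · intro l
      refine Eventually.of_forall fun u => ?_
      rw [norm_mul, norm_expI, one_mul]
    · exact (gN_integrable hi N).norm
    · refine Eventually.of_forall fun u => ?_
      fun_prop
  have hGi : IntegrableOn (fun v => GG φ N (x.1 + x.2) (k / 4 * (v - v0)) *
      Complex.exp (Complex.I * ((-(N * (x.1 + x.2)) : ℝ) : ℂ))) (Set.Ioc 0 (wd N)) := by
    apply Continuous.integrableOn_Ioc
    fun_prop
  rw [integral_sub hGi (integrableOn_const (by simp)), integral_mul_const] at hint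
  have hint2 : ‖∫ v in Set.Ioc 0 (wd N), ((I0 / 2 : ℝ) : ℂ)‖ = I0 / 2 * wd N := by
    rw [setIntegral_const, norm_smul, Complex.norm_real]
    simp [hw.le, abs_of_nonneg hI, mul_comm]
  have hlow : I0 / 4 * wd N ≤ ‖∫ v in Set.Ioc 0 (wd N), GG φ N (x.1 + x.2) (k / 4 * (v - v0))‖ := by
    have := norm_sub_norm_le (∫ v in Set.Ioc 0 (wd N), ((I0 / 2 : ℝ) : ℂ))
      ((∫ v in Set.Ioc 0 (wd N), GG φ N (x.1 + x.2) (k / 4 * (v - v0))) *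
        Complex.exp (Complex.I * ((-(N * (x.1 + x.2)) : ℝ) : ℂ)))
    rw [norm_sub_rev, hint2, norm_mul, norm_expI, mul_one] at this
    have h0 : 0 ≤ I0 * wd N := by positivity
    linarith
  unfold TT
  have hk0 : 0 ≤ k := by linarith
  rw [osc_formula hi, norm_mul, norm_mul, Complex.norm_real, Complex.norm_real,
    Real.norm_of_nonneg (by positivity), Real.norm_of_nonneg (by positivity)]
  have kw : 1 / 64 ≤ k * wd N := by
    calc (1/64 : ℝ) ≤ 127 * (wd N * N) := by rw [hwN]; norm_num
      _ = 127 * N * wd N := by ring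
      _ ≤ _ := by gcongr
  calc I0 / (2048 * π) * A = (I0 * A / (32 * π)) * (1 / 64) := by field_simp; ring
    _ ≤ (I0 * A / (32 * π)) * (k * wd N) := by gcongr
    _ = k / (4 * π) * (A / 2 * (I0 / 4 * wd N)) := by field_simp; ring
    _ ≤ _ := by gcongr

theorem H_bound {w : ℝ} (hw : 0 < w) (β : ℝ) :
    ‖∫ v in Set.Ioc 0 w, Complex.exp (Complex.I * ((-β * v : ℝ) : ℂ))‖ ^ 2
      ≤ 8 * w ^ 2 * (1 + (w * β) ^ 2)⁻¹ := by
  set H := ∫ v in Set.Ioc 0 w, Complex.exp (Complex.I * ((-β * v : ℝ) : ℂ)) with hH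
  have h1 : ‖H‖ ≤ w := by
    have := norm_setIntegral_le_of_norm_le_const (μ := volume) (s := Set.Ioc 0 w)
      (f := fun v : ℝ => Complex.exp (Complex.I * ((-β * v : ℝ) : ℂ))) (C := 1) (by simp)
      (fun v _ => (norm_expI _).le)
    refine this.trans (by simp [hw.le])
  have h2 : ‖H‖ * |β| ≤ 2 := by
    by_cases hb : β = 0
    · simp [hb]
    have hc : (-(Complex.I * (β : ℂ))) ≠ 0 := by
      simp [hb]
    have : H = (Complex.exp (-(Complex.I * (β : ℂ)) * w) -
        Complex.exp (-(Complex.I * (β : ℂ)) * (0 : ℝ))) / (-(Complex.I * (β : ℂ))) := by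
      rw [← integral_exp_mul_complex hc, intervalIntegral.integral_of_le hw.le, hH]
      congr 1
      ext v
      push_cast
      ring_nf
    rw [this, norm_div]
    have n1 : ‖-(Complex.I * (β : ℂ))‖ = |β| := by simp
    rw [n1, div_mul_cancel₀ _ (by simpa using hb)]
    refine (norm_sub_le _ _).trans ?_
    have e1 : -(Complex.I * (β : ℂ)) * w = Complex.I * ((-β * w : ℝ) : ℂ) := by push_cast; ring
    rw [e1, norm_expI]
    norm_num
  rw [← div_eq_mul_inv, le_div_iff₀ (by positivity)]
  have h3 : ‖H‖ ^ 2 ≤ w ^ 2 := by gcongr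
  have h4 : (‖H‖ * |β|) ^ 2 ≤ 2 ^ 2 := by gcongr
  rw [mul_pow, sq_abs] at h4
  nlinarith [sq_nonneg w]

theorem FT_formula {φ : ℝ → ℝ} (N A : ℝ) (ξ : ℝ × ℝ) :
    FT (fun z => ((VR φ N A z : ℝ) : ℂ)) ξ = ((A / 2 : ℝ) : ℂ) *
      (GG φ N 0 (-((ξ.1 + ξ.2) / 2)) * ∫ v in Set.Ioc 0 (wd N),
        Complex.exp (Complex.I * ((-((ξ.1 - ξ.2) / 2) * v : ℝ) : ℂ))) := by
  unfold FT
  let f : ℝ → ℂ := fun u => (A : ℂ) * (Complex.exp (Complex.I * ((-((ξ.1 + ξ.2) / 2) * (u - 0) : ℝ) : ℂ)) *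
    gN φ N u)
  let g : ℝ → ℂ := fun v => (Set.Ioc 0 (wd N)).indicator
    (fun v : ℝ => Complex.exp (Complex.I * ((-((ξ.1 - ξ.2) / 2) * v : ℝ) : ℂ))) v
  have e : ∀ z : ℝ × ℝ, Complex.exp (-(Complex.I * ((z.1 * ξ.1 + z.2 * ξ.2 : ℝ) : ℂ))) *
      ((VR φ N A z : ℝ) : ℂ) = f (z.1 + z.2) * g (z.1 - z.2) := by
    intro z
    rw [VR_eq]
    by_cases h : z.1 - z.2 ∈ Set.Ioc 0 (wd N)
    · simp only [f, g, hN, h, Set.indicator_of_mem]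
      have : Complex.exp (-(Complex.I * ((z.1 * ξ.1 + z.2 * ξ.2 : ℝ) : ℂ))) =
        Complex.exp (Complex.I * ((-((ξ.1 + ξ.2) / 2) * (z.1 + z.2 - 0) : ℝ) : ℂ)) *
        Complex.exp (Complex.I * ((-((ξ.1 - ξ.2) / 2) * (z.1 - z.2) : ℝ) : ℂ)) := by
        rw [← Complex.exp_add]
        congr 1
        push_cast
        ring
      rw [this]
      ring
    · simp [g, hN, h]
  simp_rw [e]
  rw [integral_rot (fun y : ℝ × ℝ => f y.1 * g y.2), Measure.volume_eq_prod, integral_prod_mul]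
  simp only [f, g]
  rw [integral_indicator measurableSet_Ioc, integral_const_mul]
  unfold GG
  push_cast
  ring

theorem sob_pt {s : ℝ} (hs : 0 < s) (hs' : s < 1/2) {N α β w A C n g h p q : ℝ} (hN : 1 ≤ N)
    (hw : w * N = 1 / 4096) (hA : 0 ≤ A) (hn0 : 0 ≤ n) (hC : 0 ≤ C) (hh0 : 0 ≤ h)
    (hn : n = A / 2 * (g * h)) (hg0 : 0 ≤ g)
    (hp : p = (1 + (-α + N) ^ 2)⁻¹) (hq : q = (1 + (-α - N) ^ 2)⁻¹)
    (hg : g ≤ C / 2 * (p + q)) (hh : h ^ 2 ≤ 8 * w ^ 2 * (1 + (w * β) ^ 2)⁻¹) :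
    (1 + 2 * α ^ 2 + 2 * β ^ 2) ^ s * n ^ 2 ≤
      (2 * 4096 ^ 2 * A ^ 2 * C ^ 2 * w ^ 2 * N ^ (2 * s)) *
        ((p + q) * (1 + (w * β) ^ 2) ^ (s - 1)) := by
  set W := 1 + 2 * α ^ 2 + 2 * β ^ 2 with hW
  set Γ := 1 + (w * β) ^ 2 with hΓ
  have hΓ0 : 0 < Γ := by positivity
  have hW0 : 0 < W := by positivity
  have hp0 : 0 < p := by rw [hp]; positivity
  have hq0 : 0 < q := by rw [hq]; positivity
  have hb : β ^ 2 = 4096 ^ 2 * N ^ 2 * (w * β) ^ 2 := by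
    have : (w * N) ^ 2 = (1 / 4096) ^ 2 := by rw [hw]
    calc β ^ 2 = 4096 ^ 2 * (1 / 4096) ^ 2 * β ^ 2 := by norm_num
      _ = _ := by rw [← this]; ring
  have key : ∀ μ : ℝ, α ^ 2 ≤ 2 * N ^ 2 + 2 * μ ^ 2 →
      W ^ s * ((1 + μ ^ 2)⁻¹) ^ 2 ≤ 2 * 4096 ^ 2 * N ^ (2 * s) * (1 + μ ^ 2)⁻¹ * Γ ^ s := by
    intro μ hμ
    have hM : 0 < 1 + μ ^ 2 := by positivity
    have h1 : W ≤ (2 * 4096 ^ 2) * N ^ 2 * (1 + μ ^ 2) * Γ := by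
      have hN2 : 1 ≤ N ^ 2 := one_le_pow₀ hN
      have : W ≤ (2 * 4096 ^ 2) * N ^ 2 * (1 + μ ^ 2) + (2 * 4096 ^ 2) * N ^ 2 * (w * β) ^ 2 := by
        rw [hW]
        nlinarith [sq_nonneg μ, mul_nonneg (sub_nonneg.2 hN2) (sq_nonneg μ)]
      refine this.trans ?_
      rw [hΓ]
      have : 0 ≤ (2 * 4096 ^ 2) * N ^ 2 * (μ ^ 2 * (w * β) ^ 2) := by positivity
      nlinarith
    have h2 : W ^ s ≤ (2 * 4096 ^ 2) * N ^ (2 * s) * (1 + μ ^ 2) * Γ ^ s := by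
      refine (Real.rpow_le_rpow hW0.le h1 hs.le).trans ?_
      rw [Real.mul_rpow (by positivity) hΓ0.le, Real.mul_rpow (by positivity) hM.le,
        Real.mul_rpow (by positivity) (by positivity)]
      have a1 : ((2 * 4096 ^ 2 : ℝ)) ^ s ≤ 2 * 4096 ^ 2 :=
        Real.rpow_le_self_of_one_le (by norm_num) (by linarith)
      have a2 : (1 + μ ^ 2) ^ s ≤ 1 + μ ^ 2 :=
        Real.rpow_le_self_of_one_le (by nlinarith [sq_nonneg μ]) (by linarith)
      have a3 : (N ^ 2) ^ s = N ^ (2 * s) := by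
        rw [Real.rpow_mul (by linarith), Real.rpow_two]
      rw [a3]
      gcongr
    calc W ^ s * ((1 + μ ^ 2)⁻¹) ^ 2
        ≤ ((2 * 4096 ^ 2) * N ^ (2 * s) * (1 + μ ^ 2) * Γ ^ s) * ((1 + μ ^ 2)⁻¹) ^ 2 := by gcongr
      _ = _ := by field_simp
  have kp := key (-α + N) (by nlinarith [sq_nonneg (-α + 2 * N)])
  have kq := key (-α - N) (by nlinarith [sq_nonneg (α + 2 * N)])
  rw [← hp] at kp
  rw [← hq] at kq
  have hn2 : n ^ 2 ≤ A ^ 2 * C ^ 2 * w ^ 2 * Γ⁻¹ * (p ^ 2 + q ^ 2) := by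
    have g2 : g ^ 2 ≤ (C / 2 * (p + q)) ^ 2 := by gcongr
    have g3 : (C / 2 * (p + q)) ^ 2 ≤ C ^ 2 / 2 * (p ^ 2 + q ^ 2) := by
      nlinarith [mul_nonneg (sq_nonneg C) (sq_nonneg (p - q))]
    rw [hn]
    calc (A / 2 * (g * h)) ^ 2 = A ^ 2 / 4 * (g ^ 2 * h ^ 2) := by ring
      _ ≤ A ^ 2 / 4 * ((C ^ 2 / 2 * (p ^ 2 + q ^ 2)) * (8 * w ^ 2 * Γ⁻¹)) := by
        gcongr
        exact g2.trans g3
      _ = _ := by ring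
  have hΓs : Γ ^ (s - 1) = Γ ^ s * Γ⁻¹ := by
    rw [Real.rpow_sub hΓ0, Real.rpow_one, div_eq_mul_inv]
  rw [hΓs]
  calc W ^ s * n ^ 2 ≤ W ^ s * (A ^ 2 * C ^ 2 * w ^ 2 * Γ⁻¹ * (p ^ 2 + q ^ 2)) := by gcongr
    _ = (A ^ 2 * C ^ 2 * w ^ 2 * Γ⁻¹) * (W ^ s * p ^ 2 + W ^ s * q ^ 2) := by ring
    _ ≤ (A ^ 2 * C ^ 2 * w ^ 2 * Γ⁻¹) * (2 * 4096 ^ 2 * N ^ (2 * s) * p * Γ ^ s +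
          2 * 4096 ^ 2 * N ^ (2 * s) * q * Γ ^ s) := by gcongr
    _ = _ := by ring

theorem VR_sob {φ : ℝ → ℝ} (hi : Integrable φ) {C : ℝ} (hC0 : 0 < C)
    (hC : ∀ μ : ℝ, ‖∫ u : ℝ, Complex.exp (Complex.I * ((μ * u : ℝ) : ℂ)) * (φ u : ℂ)‖
      ≤ C / (1 + μ ^ 2)) {s : ℝ} (hs : 0 < s) (hs' : s < 1/2) :
    ∃ K : ℝ, 0 ≤ K ∧ ∀ N A : ℝ, 1 ≤ N → 0 ≤ A →
      sobNormSq s (FT (fun z => ((VR φ N A z : ℝ) : ℂ))) ≤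
        ENNReal.ofReal (K * (A ^ 2 * N ^ (2 * s) / N)) := by
  have hJ : Integrable (fun t : ℝ => (1 + t ^ 2) ^ (s - 1)) := by
    have := integrable_rpow_neg_one_add_norm_sq (E := ℝ) (μ := volume) (r := 2 - 2 * s)
      (by simp; linarith)
    convert! this using 2 with t
    rw [Real.norm_eq_abs, sq_abs]
    congr 1
    ring
  set J := ∫ t : ℝ, (1 + t ^ 2) ^ (s - 1) with hJdef
  have hJ0 : 0 ≤ J := integral_nonneg fun t => by positivity
  refine ⟨2 * 4096 * C ^ 2 * (4 * π * J), by positivity, ?_⟩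
  intro N A hN hA
  have hN0 : 0 < N := by linarith
  have hw : 0 < wd N := by unfold wd; positivity
  have hwN : wd N * N = 1 / 4096 := by unfold wd; field_simp
  set K1 := 2 * 4096 ^ 2 * A ^ 2 * C ^ 2 * wd N ^ 2 * N ^ (2 * s) with hK1
  have hK10 : 0 ≤ K1 := by positivity
  let P : ℝ → ℝ := fun t => (1 + (1 / 2 * t + -N) ^ 2)⁻¹ + (1 + (1 / 2 * t + N) ^ 2)⁻¹
  let Q : ℝ → ℝ := fun t => (1 + (wd N / 2 * t) ^ 2) ^ (s - 1)
  obtain ⟨i1, j1⟩ := int_bound (k := 1 / 2) (by norm_num) (-N)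
  obtain ⟨i2, j2⟩ := int_bound (k := 1 / 2) (by norm_num) N
  have hPi : Integrable P := i1.add i2
  have hPe : ∫ t, P t = 4 * π := by
    simp only [P]
    rw [integral_add i1 i2, j1, j2]; ring
  have hQi : Integrable Q := hJ.comp_mul_left' (by positivity : wd N / 2 ≠ 0)
  have hQe : ∫ t, Q t = 2 / wd N * J := by
    have := Measure.integral_comp_mul_left (fun t : ℝ => (1 + t ^ 2) ^ (s - 1)) (wd N / 2)
    simp only [Q]
    rw [this, abs_of_pos (by positivity), smul_eq_mul, inv_div]
  have hP0 : ∀ t, 0 ≤ P t := fun t => by simp only [P]; positivity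
  have hQ0 : ∀ t, 0 ≤ Q t := fun t => by simp only [Q]; positivity
  calc sobNormSq s (FT (fun z => ((VR φ N A z : ℝ) : ℂ)))
      ≤ ∫⁻ ξ : ℝ × ℝ, ENNReal.ofReal K1 *
          (ENNReal.ofReal (P (ξ.1 + ξ.2)) * ENNReal.ofReal (Q (ξ.1 - ξ.2))) := by
        unfold sobNormSq
        apply lintegral_mono
        intro ξ
        simp only []
        have e1 : ∀ y : ℂ, (‖y‖₊ : ℝ≥0∞) ^ 2 = ENNReal.ofReal (‖y‖ ^ 2) := by
          intro y
          rw [ENNReal.ofReal_pow (norm_nonneg _), ofReal_norm]; rfl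
        rw [e1, ← ENNReal.ofReal_mul (by positivity), ← ENNReal.ofReal_mul (hP0 _),
          ← ENNReal.ofReal_mul hK10]
        apply ENNReal.ofReal_le_ofReal
        have := sob_pt (α := (ξ.1 + ξ.2) / 2) (β := (ξ.1 - ξ.2) / 2) hs hs' hN hwN hA
          (norm_nonneg (FT (fun z => ((VR φ N A z : ℝ) : ℂ)) ξ)) hC0.le
          (norm_nonneg (∫ v in Set.Ioc 0 (wd N),
            Complex.exp (Complex.I * ((-((ξ.1 - ξ.2) / 2) * v : ℝ) : ℂ))))
          (g := ‖GG φ N 0 (-((ξ.1 + ξ.2) / 2))‖)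
          (by rw [FT_formula, norm_mul, norm_mul, Complex.norm_real,
                Real.norm_of_nonneg (by positivity)])
          (norm_nonneg _) rfl rfl (GG_bound hi hC _ _ _) (H_bound hw _)
        have eW : 1 + 2 * ((ξ.1 + ξ.2) / 2) ^ 2 + 2 * ((ξ.1 - ξ.2) / 2) ^ 2 =
          1 + ξ.1 ^ 2 + ξ.2 ^ 2 := by ring
        rw [eW] at this
        refine this.trans (le_of_eq ?_)
        simp only [P, Q]
        rw [hK1]
        congr 2
        · ring_nf
        · ring_nf
    _ = ENNReal.ofReal K1 * (ENNReal.ofReal (1/2) *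
          (ENNReal.ofReal (4 * π) * ENNReal.ofReal (2 / wd N * J))) := by
        rw [lintegral_const_mul' _ _ (by simp),
          lintegral_rot (fun y : ℝ × ℝ => ENNReal.ofReal (P y.1) * ENNReal.ofReal (Q y.2)),
          Measure.volume_eq_prod, lintegral_prod_mul (f := fun t => ENNReal.ofReal (P t))
            (g := fun t => ENNReal.ofReal (Q t)) hPi.1.aemeasurable.ennreal_ofReal
            hQi.1.aemeasurable.ennreal_ofReal,
          ← ofReal_integral_eq_lintegral_ofReal hPi (Eventually.of_forall hP0),
          ← ofReal_integral_eq_lintegral_ofReal hQi (Eventually.of_forall hQ0), hPe, hQe]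
    _ = ENNReal.ofReal (K1 * (1/2 * (4 * π * (2 / wd N * J)))) := by
        rw [← ENNReal.ofReal_mul (by positivity : (0:ℝ) ≤ 4 * π),
          ← ENNReal.ofReal_mul (by norm_num : (0:ℝ) ≤ 1/2), ← ENNReal.ofReal_mul hK10]
    _ = _ := by
        congr 1
        rw [hK1]
        unfold wd
        field_simp
        try ring

theorem tsum_integrable {F : ℕ → ℝ × ℝ → ℂ} (hF : ∀ i, Integrable (F i))
    (hS : Summable fun i => ∫ z, ‖F i z‖) : Integrable (fun z => ∑' i, F i z) := by
  refine ⟨(AEMeasurable.tsum fun i => (hF i).1.aemeasurable).aestronglyMeasurable, ?_⟩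
  unfold HasFiniteIntegral
  calc ∫⁻ z, ‖∑' i, F i z‖ₑ ≤ ∫⁻ z, ∑' i, ‖F i z‖ₑ :=
        lintegral_mono fun z => enorm_tsum_le_tsum_enorm
    _ = ∑' i, ∫⁻ z, ‖F i z‖ₑ := lintegral_tsum fun i => (hF i).1.enorm
    _ = ∑' i, ENNReal.ofReal (∫ z, ‖F i z‖) := by
        congr 1
        ext i
        rw [ofReal_integral_norm_eq_lintegral_enorm (hF i)]
    _ < ⊤ := by
        rw [← ENNReal.ofReal_tsum_of_nonneg (fun i => integral_nonneg fun z => norm_nonneg _) hS]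
        exact ENNReal.ofReal_lt_top

theorem hasSum_osc {F : ℕ → ℝ × ℝ → ℂ} (hF : ∀ i, Integrable (F i))
    (hS : Summable fun i => ∫ z, ‖F i z‖) (E : ℝ × ℝ → ℂ) (hE : Continuous E)
    (hE1 : ∀ z, ‖E z‖ = 1) :
    HasSum (fun i => ∫ z, E z * F i z) (∫ z, E z * ∑' i, F i z) := by
  have := hasSum_integral_of_summable_integral_norm (μ := (volume : Measure (ℝ × ℝ)))
    (F := fun i z => E z * F i z)
    (fun i => (hF i).bdd_mul (c := 1) hE.aestronglyMeasurable
      (Eventually.of_forall fun z => (hE1 z).le))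
    (by simpa [norm_mul, hE1] using hS)
  simpa only [tsum_mul_left] using this

theorem hasSum_TT {F : ℕ → ℝ × ℝ → ℂ} (hF : ∀ i, Integrable (F i))
    (hS : Summable fun i => ∫ z, ‖F i z‖) (k : ℝ) (x : ℝ × ℝ) :
    HasSum (fun i => TT (F i) k x) (TT (fun z => ∑' i, F i z) k x) := by
  unfold TT
  apply HasSum.mul_left
  refine hasSum_osc hF hS (fun z => Complex.exp (Complex.I * ((phase k x z : ℝ) : ℂ))) ?_ ?_
  · unfold phase; fun_prop
  · intro z; exact norm_expI _

theorem hasSum_FT {F : ℕ → ℝ × ℝ → ℂ} (hF : ∀ i, Integrable (F i))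
    (hS : Summable fun i => ∫ z, ‖F i z‖) (ξ : ℝ × ℝ) :
    HasSum (fun i => FT (F i) ξ) (FT (fun z => ∑' i, F i z) ξ) := by
  unfold FT
  refine hasSum_osc hF hS
    (fun z => Complex.exp (-(Complex.I * ((z.1 * ξ.1 + z.2 * ξ.2 : ℝ) : ℂ)))) ?_ ?_
  · fun_prop
  · intro z
    have := norm_expI (-(z.1 * ξ.1 + z.2 * ξ.2))
    rwa [Complex.ofReal_neg, mul_neg] at this

theorem FT_continuous {F : ℝ × ℝ → ℂ} (hF : Integrable F) : Continuous (FT F) := by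
  unfold FT
  have h1 : ∀ (ξ z : ℝ × ℝ),
      ‖Complex.exp (-(Complex.I * ((z.1 * ξ.1 + z.2 * ξ.2 : ℝ) : ℂ)))‖ = 1 := by
    intro ξ z
    have := norm_expI (-(z.1 * ξ.1 + z.2 * ξ.2))
    rwa [Complex.ofReal_neg, mul_neg] at this
  refine continuous_of_dominated (bound := fun z => ‖F z‖) ?_ ?_ hF.norm ?_
  · intro ξ
    refine AEStronglyMeasurable.mul (Continuous.aestronglyMeasurable ?_) hF.1
    fun_prop
  · intro ξ
    refine Eventually.of_forall fun z => ?_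
    rw [norm_mul, h1, one_mul]
  · refine Eventually.of_forall fun z => ?_
    fun_prop

theorem sq_tsum_le (b : ℕ → ℝ≥0∞) : (∑' i, b i) ^ 2 ≤ 4 * ∑' i, 4 ^ i * b i ^ 2 := by
  set S := ∑' i, 4 ^ i * b i ^ 2 with hS
  have hb : ∀ i, b i ≤ (2⁻¹ : ℝ≥0∞) ^ i * S ^ (1 / 2 : ℝ) := by
    intro i
    have h1 : 4 ^ i * b i ^ 2 ≤ S := ENNReal.le_tsum (f := fun i => 4 ^ i * b i ^ 2) i
    have h2 : (2 ^ i * b i) ^ (2 : ℝ) ≤ S := by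
      refine le_trans (le_of_eq ?_) h1
      rw [ENNReal.rpow_two, mul_pow, ← pow_mul, mul_comm i 2, pow_mul]
      norm_num
    have h3 : 2 ^ i * b i ≤ S ^ (1 / 2 : ℝ) := by
      have := ENNReal.rpow_le_rpow h2 (by norm_num : (0:ℝ) ≤ 1 / 2)
      rw [← ENNReal.rpow_mul] at this
      simpa using this
    calc b i = (2⁻¹ : ℝ≥0∞) ^ i * (2 ^ i * b i) := by
          rw [← mul_assoc, ← mul_pow, ENNReal.inv_mul_cancel (by norm_num) (by norm_num)]
          simp
      _ ≤ _ := by gcongr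
  have h4 : ∑' i, b i ≤ 2 * S ^ (1 / 2 : ℝ) := by
    refine (ENNReal.tsum_le_tsum hb).trans (le_of_eq ?_)
    rw [ENNReal.tsum_mul_right, ENNReal.tsum_geometric, ENNReal.one_sub_inv_two, inv_inv]
  calc (∑' i, b i) ^ 2 ≤ (2 * S ^ (1 / 2 : ℝ)) ^ 2 := by gcongr
    _ = 4 * S := by
      rw [mul_pow, ← ENNReal.rpow_two (S ^ (1 / 2 : ℝ)), ← ENNReal.rpow_mul]
      norm_num

theorem sob_sum (s : ℝ) {F : ℕ → ℝ × ℝ → ℂ} (hF : ∀ i, Integrable (F i))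
    (hS : Summable fun i => ∫ z, ‖F i z‖) :
    sobNormSq s (FT (fun z => ∑' i, F i z)) ≤ 4 * ∑' i, 4 ^ i * sobNormSq s (FT (F i)) := by
  have hm : ∀ i, AEMeasurable (fun ξ : ℝ × ℝ =>
      ENNReal.ofReal ((1 + ξ.1 ^ 2 + ξ.2 ^ 2) ^ s) * (‖FT (F i) ξ‖₊ : ℝ≥0∞) ^ 2) := by
    intro i
    have := (FT_continuous (hF i)).measurable
    apply Measurable.aemeasurable
    fun_prop
  unfold sobNormSq
  have e : ∀ i, (4:ℝ≥0∞) ^ i * ∫⁻ ξ : ℝ × ℝ,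
      ENNReal.ofReal ((1 + ξ.1 ^ 2 + ξ.2 ^ 2) ^ s) * (‖FT (F i) ξ‖₊ : ℝ≥0∞) ^ 2 =
      ∫⁻ ξ : ℝ × ℝ, (4:ℝ≥0∞) ^ i * (ENNReal.ofReal ((1 + ξ.1 ^ 2 + ξ.2 ^ 2) ^ s) *
        (‖FT (F i) ξ‖₊ : ℝ≥0∞) ^ 2) := fun i =>
    (lintegral_const_mul' _ _ (by finiteness)).symm
  simp_rw [e]
  rw [← lintegral_tsum (fun i => (hm i).const_mul _), ← lintegral_const_mul' _ _ (by norm_num)]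
  apply lintegral_mono
  intro ξ
  simp only []
  have h1 : (‖FT (fun z => ∑' i, F i z) ξ‖₊ : ℝ≥0∞) ≤ ∑' i, (‖FT (F i) ξ‖₊ : ℝ≥0∞) := by
    rw [← (hasSum_FT hF hS ξ).tsum_eq]
    exact enorm_tsum_le_tsum_enorm (f := fun i => FT (F i) ξ)
  calc ENNReal.ofReal ((1 + ξ.1 ^ 2 + ξ.2 ^ 2) ^ s) * (‖FT (fun z => ∑' i, F i z) ξ‖₊ : ℝ≥0∞) ^ 2
      ≤ ENNReal.ofReal ((1 + ξ.1 ^ 2 + ξ.2 ^ 2) ^ s) *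
        (4 * ∑' i, 4 ^ i * (‖FT (F i) ξ‖₊ : ℝ≥0∞) ^ 2) := by
        gcongr
        exact (pow_le_pow_left' h1 2).trans (sq_tsum_le _)
    _ = _ := by
        rw [mul_left_comm, ← ENNReal.tsum_mul_left]
        congr 2
        ext i
        ring

theorem exists_seq {s : ℝ} (hs : 0 < s) (hs' : s < 1/2) (R : ℝ) (hR : 8 ≤ R) :
    ∃ N A : ℕ → ℝ, (∀ i, R ≤ N i) ∧ (∀ i, R ^ (i + 1) ≤ A i) ∧ (∀ i, R * A i ≤ A (i + 1)) ∧
      (∀ i, A i ^ 2 * N i ^ (2 * s) / N i ≤ (1 / 8) ^ i) ∧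
      (∀ i, N i * (A (i + 1) / N (i + 1)) ≤ 1) ∧
      (∀ i, A (i + 1) / N (i + 1) ≤ A i / N i / 2) := by
  set a := 1 / 2 - s with ha
  have ha0 : 0 < a := by linarith
  obtain ⟨N0, hN0R, hB⟩ : ∃ N0 : ℝ, R ≤ N0 ∧ R ≤ N0 ^ (a / 2) :=
    ((eventually_ge_atTop R).and
      ((tendsto_rpow_atTop (by positivity : 0 < a / 2)).eventually (eventually_ge_atTop R))).exists
  set N : ℕ → ℝ := fun i => N0 ^ (4 ^ i) with hN
  set A : ℕ → ℝ := fun i => N i ^ (a / 2) with hA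
  have hNs : ∀ i, N (i + 1) = N i ^ 4 := by
    intro i; simp only [hN]; rw [← pow_mul, pow_succ]
  have hNR : ∀ i, R ≤ N i := by
    intro i
    exact hN0R.trans (le_self_pow₀ (by linarith) (by positivity))
  have hNpos : ∀ i, 0 < N i := fun i => by linarith [hNR i]
  have hAs : ∀ i, A (i + 1) = A i ^ 4 := by
    intro i
    simp only [hA]
    rw [hNs, ← Real.rpow_natCast, ← Real.rpow_natCast, ← Real.rpow_mul (hNpos i).le,
      ← Real.rpow_mul (hNpos i).le, mul_comm]
  have hApos : ∀ i, 0 < A i := fun i => Real.rpow_pos_of_pos (hNpos i) _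
  have hAR : ∀ i, R ≤ A i := by
    intro i
    induction i with
    | zero => simpa [hA, hN] using hB
    | succ i ih => rw [hAs]; exact ih.trans (le_self_pow₀ (by linarith) (by norm_num))
  have hAm : ∀ i, R * A i ≤ A (i + 1) := by
    intro i
    rw [hAs]
    have h1 := hAR i
    have : A i * A i ≤ A i ^ 4 := by
      rw [← sq]; exact pow_le_pow_right₀ (by linarith) (by norm_num)
    nlinarith
  have hAp : ∀ i, R ^ (i + 1) ≤ A i := by
    intro i
    induction i with
    | zero => simpa using hAR 0
    | succ i ih =>
      refine le_trans ?_ (hAm i)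
      rw [pow_succ, mul_comm]
      exact mul_le_mul_of_nonneg_left ih (by linarith)
  have hAN : ∀ i, A i ^ 4 ≤ N i := by
    intro i
    simp only [hA]
    rw [← Real.rpow_natCast, ← Real.rpow_mul (hNpos i).le]
    refine (Real.rpow_le_rpow_of_exponent_le (by linarith [hNR i]) ?_).trans (Real.rpow_one _).le
    push_cast
    linarith
  refine ⟨N, A, hNR, hAp, hAm, ?_, ?_, ?_⟩
  · intro i
    have h1 : A i ^ 2 * N i ^ (2 * s) / N i = (A i ^ 2)⁻¹ := by
      have e1 : A i ^ 2 = N i ^ a := by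
        simp only [hA]
        rw [← Real.rpow_natCast, ← Real.rpow_mul (hNpos i).le]
        congr 1
        push_cast; ring
      rw [e1, ← Real.rpow_add (hNpos i), ← Real.rpow_neg (hNpos i).le]
      nth_rewrite 2 [← Real.rpow_one (N i)]
      rw [← Real.rpow_sub (hNpos i)]
      congr 1
      rw [ha]; ring
    rw [h1, one_div, inv_pow]
    apply inv_anti₀ (by positivity)
    have h2 : (8:ℝ) ^ i ≤ A i := by
      refine le_trans ?_ (hAp i)
      calc (8:ℝ) ^ i ≤ 8 ^ (i + 1) := pow_le_pow_right₀ (by norm_num) (by omega)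
        _ ≤ R ^ (i + 1) := by gcongr
    have := hAR i
    nlinarith
  · intro i
    rw [hAs, hNs, ← mul_div_assoc, div_le_one (pow_pos (hNpos i) 4)]
    have := hNR i
    calc N i * A i ^ 4 ≤ N i * N i := by
          exact mul_le_mul_of_nonneg_left (hAN i) (hNpos i).le
      _ = N i ^ 2 := by ring
      _ ≤ N i ^ 4 := pow_le_pow_right₀ (by linarith) (by norm_num)
  · intro i
    rw [hAs, hNs, ← div_pow]
    set D := A i / N i with hD
    have hD0 : 0 < D := div_pos (hApos i) (hNpos i)
    have hD1 : D ≤ 1 / 2 := by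
      rw [hD, div_le_iff₀ (hNpos i)]
      have h1 := hAN i
      have h2 := hAR i
      have : A i * 2 ≤ A i ^ 4 := by
        calc A i * 2 ≤ A i * A i := by nlinarith
          _ = A i ^ 2 := by ring
          _ ≤ A i ^ 4 := pow_le_pow_right₀ (by linarith) (by norm_num)
      linarith
    have : D ^ 4 ≤ D ^ 2 := pow_le_pow_of_le_one hD0.le (by linarith) (by norm_num)
    nlinarith

theorem sum_lower {t : ℕ → ℂ} {T : ℂ} (ht : HasSum t T) {A D : ℕ → ℝ} {C c R L : ℝ} (j : ℕ)
    (hC : 0 < C) (hA0 : ∀ i, 0 ≤ A i) (hA : ∀ i, R * A i ≤ A (i + 1)) (hR : 8 ≤ R)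
    (hCR : C ≤ c / 2 * (R - 1)) (hL : 0 ≤ L)
    (hD : ∀ i, D (i + 1) ≤ D i / 2)
    (h1 : ∀ i, ‖t i‖ ≤ C * A i) (h2 : c * A j ≤ ‖t j‖) (h3 : ∀ i, ‖t i‖ ≤ L * D i) :
    c / 2 * A j - 2 * (L * D (j + 1)) ≤ ‖T‖ := by
  have hsum : ∀ n, (R - 1) * ∑ i ∈ Finset.range n, A i ≤ A n := by
    intro n
    induction n with
    | zero => simpa using hA0 0
    | succ n ih => rw [Finset.sum_range_succ]; nlinarith [hA n]
  have hDm : ∀ m, D (m + (j + 1)) ≤ D (j + 1) * (1 / 2) ^ m := by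
    intro m
    induction m with
    | zero => simp
    | succ m ih =>
      have := hD (m + (j + 1))
      rw [show m + 1 + (j + 1) = m + (j + 1) + 1 by ring, pow_succ]
      linarith
  have hg : HasSum (fun m : ℕ => L * D (j + 1) * (1 / 2 : ℝ) ^ m) (L * D (j + 1) * 2) :=
    hasSum_geometric_two.mul_left _
  have htail : ‖∑' m, t (m + (j + 1))‖ ≤ L * D (j + 1) * 2 := by
    refine tsum_of_norm_bounded hg fun m => (h3 _).trans ?_
    rw [mul_assoc]
    exact mul_le_mul_of_nonneg_left (hDm m) hL
  have hhead : ‖∑ i ∈ Finset.range j, t i‖ ≤ c / 2 * A j := by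
    calc ‖∑ i ∈ Finset.range j, t i‖ ≤ ∑ i ∈ Finset.range j, C * A i :=
          (norm_sum_le _ _).trans (Finset.sum_le_sum fun i _ => h1 i)
      _ = C * ∑ i ∈ Finset.range j, A i := by rw [Finset.mul_sum]
      _ ≤ (c / 2 * (R - 1)) * ∑ i ∈ Finset.range j, A i :=
          mul_le_mul_of_nonneg_right hCR (Finset.sum_nonneg fun i _ => hA0 i)
      _ = c / 2 * ((R - 1) * ∑ i ∈ Finset.range j, A i) := by ring
      _ ≤ c / 2 * A j := by
          have : 0 ≤ c / 2 := by
            by_contra h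
            nlinarith
          exact mul_le_mul_of_nonneg_left (hsum j) this
  have hT : T = (∑ i ∈ Finset.range j, t i + t j) + ∑' m, t (m + (j + 1)) := by
    rw [← Finset.sum_range_succ, ht.summable.sum_add_tsum_nat_add, ht.tsum_eq]
  have e : t j = T - ∑ i ∈ Finset.range j, t i - ∑' m, t (m + (j + 1)) := by
    rw [hT]; ring
  have : ‖t j‖ ≤ ‖T‖ + ‖∑ i ∈ Finset.range j, t i‖ + ‖∑' m, t (m + (j + 1))‖ := by
    rw [e]
    exact (norm_sub_le _ _).trans (add_le_add_left (norm_sub_le _ _) _)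
  linarith

/-- the analytic core of the sharpness result, Theorem 1.4. For
every `0 < s < 1/2` there is a compactly supported, a.e. real-valued `V ∈ L¹(ℝ²)`
with finite `H^s` norm such that `limsup_{k→∞} |T^k_1[V](x)| = ∞` on a set of
positive Lebesgue measure; in particular `T^k_1[V](x)` fails to converge to `V(x)`
on a set of positive Lebesgue measure. -/
theorem stmt15 (s : ℝ) (hs : 0 < s) (hs' : s < 1/2) :
    ∃ V : ℝ × ℝ → ℂ, Integrable V volume ∧ HasCompactSupport V ∧
      (∀ᵐ x : ℝ × ℝ, (V x).im = 0) ∧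
      sobNormSq s (FT V) < ⊤ ∧
      0 < volume {x : ℝ × ℝ |
        Filter.limsup (fun k : ℕ => (‖TT V (k : ℝ) x‖₊ : ℝ≥0∞)) Filter.atTop = ⊤} ∧
      0 < volume {x : ℝ × ℝ |
        ¬ Filter.Tendsto (fun k : ℕ => TT V (k : ℝ) x) Filter.atTop (nhds (V x))} := by
  obtain ⟨φ, hφc, hp, hsupp, hI, hi, C, hC0, hC⟩ := exists_phi
  set I0 := ∫ u, φ u with hI0
  obtain ⟨K, hK0, hK⟩ := VR_sob hi hC0 hC hs hs'
  set c := I0 / (2048 * π) with hc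
  have hc0 : 0 < c := by positivity
  obtain ⟨R, hR8, hRC, hRI⟩ : ∃ R : ℝ, 8 ≤ R ∧ C ≤ c / 2 * (R - 1) ∧ 8 * C / I0 ≤ R := by
    refine ⟨8 + 2 * C / c + 8 * C / I0, ?_, ?_, ?_⟩
    · have : 0 ≤ 2 * C / c + 8 * C / I0 := by positivity
      linarith
    · have h1 : c / 2 * (2 * C / c) = C := by field_simp
      have h2 : 0 ≤ c / 2 * (7 + 8 * C / I0) := by positivity
      nlinarith
    · have : 0 ≤ 2 * C / c := by positivity
      linarith
  obtain ⟨N, A, hNR, hAp, hAm, hsob, hND, hDD⟩ := exists_seq hs hs' R hR8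
  have hN8 : ∀ i, 8 ≤ N i := fun i => hR8.trans (hNR i)
  have hN0 : ∀ i, 0 < N i := fun i => by linarith [hN8 i]
  have hA0 : ∀ i, 0 ≤ A i := fun i => le_trans (by positivity) (hAp i)
  have hNC : ∀ i, C / (1 + (2 * N i) ^ 2) ≤ I0 / 8 := by
    intro i
    have h1 : 8 * C ≤ N i * I0 := by
      rw [← div_le_iff₀ hI]; exact hRI.trans (hNR i)
    have h2 := hN8 i
    rw [div_le_iff₀ (by positivity)]
    have h3 : N i ≤ 1 + (2 * N i) ^ 2 := by nlinarith
    have h4 : N i * I0 ≤ (1 + (2 * N i) ^ 2) * I0 := mul_le_mul_of_nonneg_right h3 hI.le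
    linarith
  set F : ℕ → ℝ × ℝ → ℂ := fun i z => ((VR φ (N i) (A i) z : ℝ) : ℂ) with hF
  have hFi : ∀ i, Integrable (F i) := fun i => VR_integrable hi _ _
  have hF1 : ∀ i, ∫ z, ‖F i z‖ ≤ I0 * (A i / N i) := fun i => VR_L1 hi hp (hN0 i) (hA0 i)
  have hDm : ∀ m, A m / N m ≤ A 0 / N 0 * (1 / 2) ^ m := by
    intro m
    induction m with
    | zero => simp
    | succ m ih =>
      have := hDD m
      rw [pow_succ]
      linarith
  have hFS : Summable fun i => ∫ z, ‖F i z‖ := by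
    refine Summable.of_nonneg_of_le (fun i => integral_nonneg fun z => norm_nonneg _)
      (fun i => (hF1 i).trans (mul_le_mul_of_nonneg_left (hDm i) hI.le)) ?_
    exact (summable_geometric_two.mul_left _).mul_left _
  have hdiv : ∀ x : ℝ × ℝ, |x.1 + x.2| ≤ 1 → 1 / 64 < x.1 - x.2 → x.1 - x.2 < 1 / 32 →
      Filter.limsup (fun k : ℕ => (‖TT (fun z => ∑' i, F i z) (k : ℝ) x‖₊ : ℝ≥0∞))
        Filter.atTop = ⊤ := by
    intro x hu hv1 hv2
    have key : ∀ j : ℕ, ∃ k : ℕ, 127 * N j ≤ k ∧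
        c / 2 * A j - 514 * I0 ≤ ‖TT (fun z => ∑' i, F i z) (k : ℝ) x‖ := by
      intro j
      have hv0 : 0 < x.1 - x.2 := by linarith
      have hf1 := Nat.floor_le (a := 4 * N j / (x.1 - x.2)) (by have := hN0 j; positivity)
      have hf2 := (Nat.lt_floor_add_one (4 * N j / (x.1 - x.2))).le
      set k := ⌊4 * N j / (x.1 - x.2)⌋₊ with hk
      rw [le_div_iff₀ hv0] at hf1
      rw [div_le_iff₀ hv0] at hf2
      have hkk : |(k : ℝ) * (x.1 - x.2) - 4 * N j| ≤ x.1 - x.2 := by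
        rw [abs_le]; constructor <;> linarith
      obtain ⟨k1, k2, k3⟩ := TT_lower hi hp hsupp hC (hNC j) (by linarith [hN8 j]) (hA0 j)
        hu hv1 hv2 hkk
      refine ⟨k, k1, ?_⟩
      have hk0 : (0:ℝ) < k := by linarith [hN8 j]
      have := sum_lower (hasSum_TT hFi hFS k x) (A := A) (D := fun i => A i / N i) (C := C)
        (c := c) (R := R) (L := k * I0) j hC0 hA0 hAm hR8 hRC (by positivity) hDD
        (fun i => TT_upper hi hC0 hC (hA0 i) hk0 x) k3
        (fun i => by
          refine (TT_L1 (F i) k hk0.le x).trans ?_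
          rw [mul_assoc]
          exact mul_le_mul_of_nonneg_left (hF1 i) hk0.le)
      refine le_trans ?_ this
      have h5 : (k : ℝ) * I0 * (A (j + 1) / N (j + 1)) ≤ 257 * I0 := by
        have hD0 : 0 ≤ A (j + 1) / N (j + 1) := div_nonneg (hA0 _) (hN0 _).le
        calc (k : ℝ) * I0 * (A (j + 1) / N (j + 1))
            ≤ (257 * N j) * I0 * (A (j + 1) / N (j + 1)) := by gcongr
          _ = 257 * I0 * (N j * (A (j + 1) / N (j + 1))) := by ring
          _ ≤ 257 * I0 * 1 := mul_le_mul_of_nonneg_left (hND j) (by positivity)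
          _ = 257 * I0 := by ring
      linarith
    have hAbig : ∀ j : ℕ, (j : ℝ) ≤ A j := by
      intro j
      refine le_trans ?_ (hAp j)
      have h1 : (j : ℝ) < 2 ^ j := by exact_mod_cast Nat.lt_two_pow_self
      have h2 : (2:ℝ) ^ j ≤ R ^ (j + 1) :=
        calc (2:ℝ) ^ j ≤ 2 ^ (j + 1) := pow_le_pow_right₀ (by norm_num) (by omega)
          _ ≤ R ^ (j + 1) := by gcongr; linarith
      linarith
    have hNbig : ∀ j : ℕ, (j : ℝ) ≤ 127 * N j := by
      intro j
      cases j with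
      | zero => have := hN0 0; simp only [Nat.cast_zero]; positivity
      | succ j =>
        have h1 := hND j
        rw [← mul_div_assoc, div_le_one (hN0 _)] at h1
        have h2 := hAbig (j + 1)
        have h3 : A (j + 1) ≤ N j * A (j + 1) :=
          le_mul_of_one_le_left (hA0 _) (by linarith [hN8 j])
        linarith [hN0 (j + 1)]
    rw [eq_top_iff]
    refine ENNReal.le_of_forall_nnreal_lt fun r _ => ?_
    refine Filter.le_limsup_of_frequently_le ?_
    rw [Filter.frequently_atTop]
    intro a
    obtain ⟨j, hj⟩ := exists_nat_ge (max (a : ℝ) ((r + 514 * I0) / (c / 2)))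
    obtain ⟨k, hk1, hk2⟩ := key j
    refine ⟨k, ?_, ?_⟩
    · have := (le_max_left _ _).trans (hj.trans ((hNbig j).trans hk1))
      exact_mod_cast this
    · have h1 := (le_max_right _ _).trans (hj.trans (hAbig j))
      rw [div_le_iff₀ (by positivity)] at h1
      have h2 : (r : ℝ) ≤ ‖TT (fun z => ∑' i, F i z) (k : ℝ) x‖ := by linarith
      exact_mod_cast h2
  have hsubset : {x : ℝ × ℝ | |x.1 + x.2| < 1 ∧ 1 / 64 < x.1 - x.2 ∧ x.1 - x.2 < 1 / 32} ⊆
      {x : ℝ × ℝ | Filter.limsup (fun k : ℕ =>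
        (‖TT (fun z => ∑' i, F i z) (k : ℝ) x‖₊ : ℝ≥0∞)) Filter.atTop = ⊤} :=
    fun x hx => hdiv x hx.1.le hx.2.1 hx.2.2
  have hpos : 0 < volume {x : ℝ × ℝ | Filter.limsup (fun k : ℕ =>
        (‖TT (fun z => ∑' i, F i z) (k : ℝ) x‖₊ : ℝ≥0∞)) Filter.atTop = ⊤} := by
    refine lt_of_lt_of_le (IsOpen.measure_pos volume ?_ ⟨(3 / 128, 0), ?_⟩) (measure_mono hsubset)
    · refine IsOpen.and (isOpen_lt (by fun_prop) (by fun_prop))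
        (IsOpen.and (isOpen_lt (by fun_prop) (by fun_prop)) (isOpen_lt (by fun_prop) (by fun_prop)))
    · simp only [Set.mem_ofPred_eq]
      norm_num [abs_lt]
  refine ⟨fun z => ∑' i, F i z, tsum_integrable hFi hFS, ?_, ?_, ?_, hpos, ?_⟩
  · refine HasCompactSupport.intro (K := Metric.closedBall (0 : ℝ × ℝ) 2)
      (isCompact_closedBall _ _) fun z hz => ?_
    have : ∀ i, F i z = 0 := by
      intro i
      simp only [hF]
      by_contra hne
      apply hz
      have hne' : VR φ (N i) (A i) z ≠ 0 := by exact_mod_cast hne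
      unfold VR at hne'
      have hφ : φ (z.1 + z.2) ≠ 0 := fun h => hne' (by simp [h])
      have hm : z.1 - z.2 ∈ Set.Ioc 0 (wd (N i)) := by
        by_contra h
        exact hne' (by simp [h])
      have h1 : |z.1 + z.2| < 1 := by
        by_contra h
        exact hφ (hsupp _ (not_lt.1 h))
      have h2 : wd (N i) ≤ 1 := by
        have := hN8 i
        unfold wd
        rw [div_le_one (by positivity)]
        linarith
      rw [abs_lt] at h1
      obtain ⟨h3, h4⟩ := hm
      rw [mem_closedBall_zero_iff, Prod.norm_def, max_le_iff, Real.norm_eq_abs,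
        Real.norm_eq_abs, abs_le, abs_le]
      refine ⟨⟨?_, ?_⟩, ?_, ?_⟩ <;> linarith [h1.1, h1.2]
    simp [this]
  · refine Eventually.of_forall fun z => ?_
    simp only [hF]
    rw [← Complex.ofReal_tsum]
    exact Complex.ofReal_im _
  · refine lt_of_le_of_lt (sob_sum s hFi hFS) ?_
    have hle : ∀ i, 4 ^ i * sobNormSq s (FT (F i)) ≤ ENNReal.ofReal (K * (1 / 2) ^ i) := by
      intro i
      have h1 := hK (N i) (A i) (by linarith [hN8 i]) (hA0 i)
      have h2 : K * (A i ^ 2 * N i ^ (2 * s) / N i) ≤ K * (1 / 8) ^ i :=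
        mul_le_mul_of_nonneg_left (hsob i) hK0
      have h3 : (4 : ℝ≥0∞) ^ i = ENNReal.ofReal (4 ^ i) := by
        rw [ENNReal.ofReal_pow (by norm_num)]; norm_num
      calc 4 ^ i * sobNormSq s (FT (F i))
          ≤ ENNReal.ofReal (4 ^ i) * ENNReal.ofReal (K * (1 / 8) ^ i) := by
            rw [h3]
            gcongr
            exact h1.trans (ENNReal.ofReal_le_ofReal h2)
        _ = ENNReal.ofReal (K * (1 / 2) ^ i) := by
            rw [← ENNReal.ofReal_mul (by positivity)]
            congr 1
            rw [mul_left_comm, ← mul_pow]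
            norm_num
    refine ENNReal.mul_lt_top (by norm_num) (lt_of_le_of_lt (ENNReal.tsum_le_tsum hle) ?_)
    rw [← ENNReal.ofReal_tsum_of_nonneg (fun i => by positivity)
      (summable_geometric_two.mul_left _)]
    exact ENNReal.ofReal_lt_top
  · refine lt_of_lt_of_le hpos (measure_mono fun x hx hT => ?_)
    have h1 := (ENNReal.continuous_coe.comp continuous_nnnorm).continuousAt.tendsto.comp hT
    have h2 := h1.limsup_eq
    have h3 : (⊤ : ℝ≥0∞) = ((‖∑' i, F i x‖₊ : NNReal) : ℝ≥0∞) := hx.symm.trans h2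
    exact ENNReal.coe_ne_top h3.symm

end
end

section
/- Let β ∈ (1/2, 1) and 0 < ε < min(1/4, 1−β). There exists a constant C₂, depending only on φ₀, β and ε, such that for every integer j ≥ 2, every x ∈ ℝ² with x₁ ∈ [1/16, 1/4] and x₂ ∈ [−1/16, 1/16], and every positive integer k with |k − 2^{j+1}/x₁| ≤ 1/2, the series Σ_{ℓ≥2, ℓ≠j} (e^{i(1/k)□}V_ℓ^+(x) + e^{i(1/k)□}V_ℓ^−(x)) converges absolutely and |Σ_{ℓ≥2, ℓ≠j} (e^{i(1/k)□}V_ℓ^+(x) + e^{i(1/k)□}V_ℓ^−(x)) + e^{i(1/k)□}V_j^−(x)| ≤ C₂ 2^{εj}. -/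
open MeasureTheory Real Filter
open scoped ENNReal

noncomputable section

/-- Convolution `φ = φ₀ ∗ φ₀` on `ℝ`. -/
def conv1 (φ₀ : ℝ → ℝ) (x : ℝ) : ℝ := ∫ t : ℝ, φ₀ t * φ₀ (x - t)

/-- The building blocks `V_j^{±}(x) = 2^{(1-β)j} e^{± i 2^j x₂} φ(2^j x₁) φ(x₂)` of the
counterexample potential, with sign `sg = ±1`. -/
def Vpm (φ₀ : ℝ → ℝ) (β : ℝ) (j : ℕ) (sg : ℝ) (x : ℝ × ℝ) : ℂ :=
  (((2 : ℝ) ^ ((1 - β) * (j : ℝ)) : ℝ) : ℂ) *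
    Complex.exp (Complex.I * ((sg * 2 ^ j * x.2 : ℝ) : ℂ)) *
    ((conv1 φ₀ (2 ^ j * x.1) : ℝ) : ℂ) * ((conv1 φ₀ x.2 : ℝ) : ℂ)

/-- The nonelliptic Schrödinger evolution, in rotated coordinates, of `V_ℓ^{sg}` at
time `1/k`: `e^{i(1/k)□}V_ℓ^{sg}(x) = (2π)^{-2} ∫ e^{ix·ξ} e^{-2iξ₁ξ₂/k} V̂_ℓ^{sg}(ξ) dξ`. -/
def Eprop (φ₀ : ℝ → ℝ) (β : ℝ) (ℓ : ℕ) (sg : ℝ) (k : ℕ) (x : ℝ × ℝ) : ℂ :=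
  (2 * Real.pi : ℂ) ^ (-2 : ℤ) *
    ∫ ξ : ℝ × ℝ,
      Complex.exp (Complex.I * ((x.1 * ξ.1 + x.2 * ξ.2 : ℝ) : ℂ)) *
      Complex.exp (-(Complex.I * ((2 * ξ.1 * ξ.2 / (k : ℝ) : ℝ) : ℂ))) *
      FT (Vpm φ₀ β ℓ sg) ξ

open FourierTransform in
lemma aux_fourier (φ : ℝ → ℝ) (hs : ContDiff ℝ (⊤ : ℕ∞) φ) (hc : HasCompactSupport φ) :
    ∃ g : ℝ → ℂ, Integrable g ∧ Integrable (fun ζ => (1 + |ζ|) * ‖g ζ‖) ∧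
      (∀ ξ : ℝ, ∫ z : ℝ, Complex.exp (-(Complex.I * ((z * ξ : ℝ) : ℂ))) * ((φ z : ℝ) : ℂ) = g ξ) ∧
      (∀ a : ℝ, ∫ η : ℝ, Complex.exp (Complex.I * ((a * η : ℝ) : ℂ)) * g η
        = ((2 * Real.pi * φ a : ℝ) : ℂ)) := by
  have hpi : (2 * Real.pi) ≠ 0 := by positivity
  have h2 : ContDiff ℝ (⊤ : ℕ∞) (fun z => ((φ z : ℝ) : ℂ)) :=
    Complex.ofRealCLM.contDiff.comp hs
  have h1 : HasCompactSupport (fun z => ((φ z : ℝ) : ℂ)) :=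
    hc.comp_left (g := fun r : ℝ => (r : ℂ)) (by simp)
  let f : SchwartzMap ℝ ℂ := h1.toSchwartzMap h2
  have hf : ∀ z, f z = ((φ z : ℝ) : ℂ) := fun z => rfl
  let F : SchwartzMap ℝ ℂ := 𝓕 f
  have hF : ∀ w, F w = ∫ v : ℝ, Complex.exp ((-2 * Real.pi * v * w : ℝ) * Complex.I) * f v := by
    intro w
    have : F w = 𝓕 (f : ℝ → ℂ) w := rfl
    rw [this, Real.fourier_eq']
    congr 1; ext v
    simp
    left; ring_nf
  have hinv : ∀ a, f a = ∫ w : ℝ, Complex.exp ((2 * Real.pi * w * a : ℝ) * Complex.I) * F w := by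
    intro a
    have e : 𝓕⁻ F = f := by simp [F]
    have : (𝓕⁻ F) a = 𝓕⁻ (F : ℝ → ℂ) a := by rw [SchwartzMap.fourierInv_coe]
    rw [← e, this, Real.fourierInv_eq']
    congr 1; ext v
    simp
    left; ring_nf
  have i0 : Integrable (fun w => F w) := F.integrable
  have i1 : Integrable (fun w => |w| * ‖F w‖) := by
    simpa using F.integrable_pow_mul volume 1
  have i2 : Integrable (fun w => (1 + |2 * Real.pi * w|) * ‖F w‖) := by
    have := i0.norm.add (i1.const_mul (2 * Real.pi))
    refine this.congr (ae_of_all _ fun w => ?_)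
    simp only [Pi.add_apply, abs_mul, abs_of_pos Real.pi_pos]
    norm_num; ring
  refine ⟨fun ξ => F (ξ / (2 * Real.pi)), i0.comp_div hpi, ?_, ?_, ?_⟩
  · refine (i2.comp_div hpi).congr (ae_of_all _ fun w => ?_)
    simp only []
    rw [mul_div_cancel₀ _ hpi]
  · intro ξ
    beta_reduce
    rw [hF]
    congr 1; ext v
    rw [hf]
    congr 2
    push_cast
    field_simp
  · intro a
    have := Measure.integral_comp_div (fun w : ℝ => Complex.exp ((2 * Real.pi * w * a : ℝ) * Complex.I) * F w) (2 * Real.pi)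
    rw [← hinv, hf, abs_of_pos (by positivity)] at this
    rw [show ((2 * Real.pi * φ a : ℝ) : ℂ) = (2 * Real.pi) • ((φ a : ℝ) : ℂ) by
      push_cast; simp, ← this]
    congr 1; ext v
    congr 2
    push_cast
    field_simp

lemma conv1_eq_zero (φ₀ : ℝ → ℝ)
    (hsupp : ∀ x : ℝ, x ∉ Set.Icc (-(1/4) : ℝ) (1/4) → φ₀ x = 0) (x : ℝ) (hx : 1/2 < |x|) :
    conv1 φ₀ x = 0 := by
  unfold conv1
  rw [show (fun t => φ₀ t * φ₀ (x - t)) = fun _ => 0 from ?_]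
  · simp
  ext t
  by_cases h1 : t ∈ Set.Icc (-(1/4) : ℝ) (1/4)
  · by_cases h2 : x - t ∈ Set.Icc (-(1/4) : ℝ) (1/4)
    · exfalso
      obtain ⟨a, b⟩ := h1
      obtain ⟨c, d⟩ := h2
      have : |x| ≤ 1/2 := abs_le.2 ⟨by linarith, by linarith⟩
      linarith
    · simp [hsupp _ h2]
  · simp [hsupp _ h1]

lemma conv1_compact (φ₀ : ℝ → ℝ)
    (hsupp : ∀ x : ℝ, x ∉ Set.Icc (-(1/4) : ℝ) (1/4) → φ₀ x = 0) :
    HasCompactSupport (conv1 φ₀) := by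
  refine HasCompactSupport.intro (K := Set.Icc (-(1/2)) (1/2)) isCompact_Icc fun x hx => ?_
  apply conv1_eq_zero φ₀ hsupp
  by_contra h
  exact hx (abs_le.1 (not_lt.1 h))

lemma conv1_smooth (φ₀ : ℝ → ℝ) (hsm : ContDiff ℝ (⊤ : ℕ∞) φ₀)
    (hsupp : ∀ x : ℝ, x ∉ Set.Icc (-(1/4) : ℝ) (1/4) → φ₀ x = 0) :
    ContDiff ℝ (⊤ : ℕ∞) (conv1 φ₀) := by
  have hc : HasCompactSupport φ₀ := HasCompactSupport.intro isCompact_Icc hsupp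
  have := hc.contDiff_convolution_right (μ := volume) (ContinuousLinearMap.mul ℝ ℝ)
    (f := φ₀) hsm.continuous.locallyIntegrable hsm
  exact this

lemma aux_freq (j ℓ : ℕ) (hj : 2 ≤ j) (x k s ξ : ℝ) (hx : 1/16 ≤ x) (hx' : x ≤ 1/4)
    (hk0 : 0 < k) (hk : |k - 2 ^ (j + 1) / x| ≤ 1/2) (hs : (s = 1 ∧ ℓ ≠ j) ∨ s = -1)
    (hξ : |2 ^ ℓ * (x - 2 * ξ / k)| ≤ 1/2) :
    (2:ℝ) ^ ℓ ≤ 32 * (1 + |ξ - s * 2 ^ ℓ|) := by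
  have hab := abs_nonneg (ξ - s * 2 ^ ℓ)
  have hx0 : 0 < x := by linarith
  rcases lt_or_ge ℓ 6 with h6 | h6
  · have : (2:ℝ) ^ ℓ ≤ 2 ^ 5 := pow_le_pow_right₀ (by norm_num) (by omega)
    linarith
  have hL : (2:ℝ) ^ 6 ≤ 2 ^ ℓ := pow_le_pow_right₀ (by norm_num) h6
  have hJ : (2:ℝ) ^ 2 ≤ 2 ^ j := pow_le_pow_right₀ (by norm_num) hj
  -- comparisons of dyadic numbers
  have hcmp : (s = 1 ∧ (2 * (2:ℝ) ^ ℓ ≤ 2 ^ j ∨ 2 * (2:ℝ) ^ j ≤ 2 ^ ℓ)) ∨ s = -1 := by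
    rcases hs with ⟨h, hne⟩ | h
    · refine Or.inl ⟨h, ?_⟩
      rcases lt_or_gt_of_ne hne with h' | h'
      · left
        rw [← pow_succ']
        exact pow_le_pow_right₀ (by norm_num) h'
      · right
        rw [← pow_succ']
        exact pow_le_pow_right₀ (by norm_num) h'
    · exact Or.inr h
  have hq : (2:ℝ) ^ (j + 1) = 2 * 2 ^ j := pow_succ' _ _
  rw [hq] at hk
  generalize (2:ℝ) ^ ℓ = L at *
  generalize (2:ℝ) ^ j = J at *
  have hLp : 0 < L := by linarith
  -- k x is close to 2 J
  have hkx : |k * x - 2 * J| ≤ 1/8 := by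
    have : k * x - 2 * J = (k - 2 * J / x) * x := by field_simp
    rw [this, abs_mul, abs_of_pos hx0]
    nlinarith [abs_nonneg (k - 2 * J / x)]
  have hkJ : k ≤ 32 * J + 1/2 := by
    have h := (abs_le.1 hk).2
    have : 2 * J / x ≤ 32 * J := by
      rw [div_le_iff₀ hx0]; nlinarith
    linarith
  have hξ2 : |x * k - 2 * ξ| ≤ k / 128 := by
    have e : L * (x - 2 * ξ / k) = L * (x * k - 2 * ξ) / k := by field_simp
    rw [e, abs_div, abs_mul, abs_of_pos hLp, abs_of_pos hk0, div_le_iff₀ hk0] at hξ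
    nlinarith [abs_nonneg (x * k - 2 * ξ)]
  obtain ⟨a1, a2⟩ := abs_le.1 hkx
  obtain ⟨b1, b2⟩ := abs_le.1 hξ2
  rcases hcmp with ⟨rfl, h | h⟩ | rfl
  · have := le_abs_self (ξ - 1 * L)
    linarith
  · have := neg_abs_le (ξ - 1 * L)
    linarith
  · have := le_abs_self (ξ - (-1) * L)
    linarith

lemma aux_FT (φ₀ : ℝ → ℝ) (β : ℝ) (ℓ : ℕ) (s : ℝ) (g : ℝ → ℂ)
    (hg : ∀ ξ : ℝ, ∫ z : ℝ, Complex.exp (-(Complex.I * ((z * ξ : ℝ) : ℂ))) *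
      ((conv1 φ₀ z : ℝ) : ℂ) = g ξ) (ξ : ℝ × ℝ) :
    FT (Vpm φ₀ β ℓ s) ξ = (((2 : ℝ) ^ ((1 - β) * (ℓ : ℝ)) : ℝ) : ℂ) *
      (((((2:ℝ) ^ ℓ)⁻¹ : ℝ) : ℂ) * g (ξ.1 / 2 ^ ℓ) * g (ξ.2 - s * 2 ^ ℓ)) := by
  have hL : (0:ℝ) < 2 ^ ℓ := by positivity
  have h1 : ∫ z : ℝ, Complex.exp (-(Complex.I * ((z * ξ.1 : ℝ) : ℂ))) *
      ((conv1 φ₀ (2 ^ ℓ * z) : ℝ) : ℂ) = ((((2:ℝ) ^ ℓ)⁻¹ : ℝ) : ℂ) * g (ξ.1 / 2 ^ ℓ) := by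
    have := Measure.integral_comp_mul_left (fun z : ℝ =>
      Complex.exp (-(Complex.I * ((z * (ξ.1 / 2 ^ ℓ) : ℝ) : ℂ))) * ((conv1 φ₀ z : ℝ) : ℂ)) (2 ^ ℓ)
    rw [hg, abs_of_pos (by positivity), Complex.real_smul] at this
    rw [← this]
    congr 1; ext z
    congr 4
    field_simp
  rw [← hg (ξ.2 - s * 2 ^ ℓ), ← h1, ← integral_prod_mul, ← integral_const_mul]
  unfold FT Vpm
  rw [← Measure.volume_eq_prod]
  congr 1; ext z
  have : Complex.exp (-(Complex.I * ((z.1 * ξ.1 + z.2 * ξ.2 : ℝ) : ℂ))) *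
      Complex.exp (Complex.I * ((s * 2 ^ ℓ * z.2 : ℝ) : ℂ)) =
      Complex.exp (-(Complex.I * ((z.1 * ξ.1 : ℝ) : ℂ))) *
      Complex.exp (-(Complex.I * ((z.2 * (ξ.2 - s * 2 ^ ℓ) : ℝ) : ℂ))) := by
    rw [← Complex.exp_add, ← Complex.exp_add]
    congr 1
    push_cast; ring
  linear_combination ((((2 : ℝ) ^ ((1 - β) * (ℓ : ℝ)) : ℝ) : ℂ) *
    ((conv1 φ₀ (2 ^ ℓ * z.1) : ℝ) : ℂ) * ((conv1 φ₀ z.2 : ℝ) : ℂ)) * this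

lemma aux_E (φ₀ : ℝ → ℝ) (β : ℝ) (ℓ : ℕ) (s : ℝ) (g : ℝ → ℂ) (k : ℕ) (x : ℝ × ℝ)
    (gi : Integrable g)
    (hg : ∀ ξ : ℝ, ∫ z : ℝ, Complex.exp (-(Complex.I * ((z * ξ : ℝ) : ℂ))) *
      ((conv1 φ₀ z : ℝ) : ℂ) = g ξ)
    (hinv : ∀ a : ℝ, ∫ η : ℝ, Complex.exp (Complex.I * ((a * η : ℝ) : ℂ)) * g η
        = ((2 * Real.pi * conv1 φ₀ a : ℝ) : ℂ)) :
    Eprop φ₀ β ℓ s k x = (2 * Real.pi : ℂ) ^ (-2 : ℤ) *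
      ((((2 : ℝ) ^ ((1 - β) * (ℓ : ℝ)) : ℝ) : ℂ) *
      ∫ ξ : ℝ, Complex.exp (Complex.I * ((x.2 * ξ : ℝ) : ℂ)) * g (ξ - s * 2 ^ ℓ) *
        ((2 * Real.pi * conv1 φ₀ (2 ^ ℓ * (x.1 - 2 * ξ / k)) : ℝ) : ℂ)) := by
  have hL : (0:ℝ) < 2 ^ ℓ := by positivity
  unfold Eprop
  simp_rw [aux_FT φ₀ β ℓ s g hg]
  congr 1
  rw [← integral_const_mul, Measure.volume_eq_prod, integral_prod_symm]
  · congr 1; ext ξ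
    have := Measure.integral_comp_div (fun η : ℝ => Complex.exp (Complex.I *
      ((2 ^ ℓ * (x.1 - 2 * ξ / k) * η : ℝ) : ℂ)) * g η) (2 ^ ℓ)
    rw [hinv, abs_of_pos hL, Complex.real_smul] at this
    have h2 : ((2 * Real.pi * conv1 φ₀ (2 ^ ℓ * (x.1 - 2 * ξ / k)) : ℝ) : ℂ) =
      ((((2:ℝ) ^ ℓ)⁻¹ : ℝ) : ℂ) * ∫ η : ℝ, Complex.exp (Complex.I *
      ((2 ^ ℓ * (x.1 - 2 * ξ / k) * (η / 2 ^ ℓ) : ℝ) : ℂ)) * g (η / 2 ^ ℓ) := by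
      rw [this, ← mul_assoc, ← Complex.ofReal_mul, inv_mul_cancel₀ hL.ne']
      simp
    rw [h2, ← mul_assoc, ← mul_assoc, ← integral_const_mul]
    congr 1; ext η
    have e : Complex.exp (Complex.I * ((x.1 * η + x.2 * ξ : ℝ) : ℂ)) *
      Complex.exp (-(Complex.I * ((2 * η * ξ / (k : ℝ) : ℝ) : ℂ))) =
      Complex.exp (Complex.I * ((x.2 * ξ : ℝ) : ℂ)) * Complex.exp (Complex.I *
      ((2 ^ ℓ * (x.1 - 2 * ξ / k) * (η / 2 ^ ℓ) : ℝ) : ℂ)) := by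
      rw [← Complex.exp_add, ← Complex.exp_add]
      congr 1
      rw [show 2 ^ ℓ * (x.1 - 2 * ξ / k) * (η / 2 ^ ℓ) = (x.1 - 2 * ξ / k) * η by field_simp]
      push_cast; ring
    simp only []
    rw [e]
    ring
  · have h := ((gi.comp_div hL.ne').mul_prod (gi.comp_sub_right (s * 2 ^ ℓ))).const_mul
      ((((2 : ℝ) ^ ((1 - β) * (ℓ : ℝ)) : ℝ) : ℂ) * ((((2:ℝ) ^ ℓ)⁻¹ : ℝ) : ℂ))
    have h' := h.bdd_mul (c := 1) (f := fun ξ : ℝ × ℝ =>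
      Complex.exp (Complex.I * ((x.1 * ξ.1 + x.2 * ξ.2 : ℝ) : ℂ)) *
      Complex.exp (-(Complex.I * ((2 * ξ.1 * ξ.2 / (k : ℝ) : ℝ) : ℂ)))) ?_ ?_
    · refine h'.congr (ae_of_all _ fun ξ => ?_)
      simp only []
      ring
    · apply Continuous.aestronglyMeasurable
      fun_prop
    · refine ae_of_all _ fun ξ => ?_
      rw [norm_mul, ← mul_neg, ← Complex.ofReal_neg, mul_comm Complex.I, mul_comm Complex.I,
        Complex.norm_exp_ofReal_mul_I, Complex.norm_exp_ofReal_mul_I]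
      norm_num

lemma aux_bound (φ₀ : ℝ → ℝ) (hsm : ContDiff ℝ (⊤ : ℕ∞) φ₀)
    (hsupp : ∀ x : ℝ, x ∉ Set.Icc (-(1/4) : ℝ) (1/4) → φ₀ x = 0) (β : ℝ) :
    ∃ C : ℝ, 0 < C ∧ ∀ (j ℓ : ℕ) (x : ℝ × ℝ) (k : ℕ) (s : ℝ), 2 ≤ j →
      x.1 ∈ Set.Icc (1/16 : ℝ) (1/4) → 0 < k → |(k : ℝ) - 2 ^ (j + 1) / x.1| ≤ 1/2 →
      ((s = 1 ∧ ℓ ≠ j) ∨ s = -1) →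
      ‖Eprop φ₀ β ℓ s k x‖ ≤ C * ((2:ℝ) ^ (-β)) ^ ℓ := by
  have hS := conv1_smooth φ₀ hsm hsupp
  have hK := conv1_compact φ₀ hsupp
  obtain ⟨g, gi, gi1, hg, hinv⟩ := aux_fourier (conv1 φ₀) hS hK
  obtain ⟨M, hM⟩ := hK.exists_bound_of_continuous hS.continuous
  have hM0 : 0 ≤ M := (norm_nonneg _).trans (hM 0)
  set G := ∫ ζ, (1 + |ζ|) * ‖g ζ‖ with hG
  have hG0 : 0 ≤ G := integral_nonneg fun ζ => by positivity
  refine ⟨‖(2 * Real.pi : ℂ) ^ (-2 : ℤ)‖ * (64 * Real.pi * M * G) + 1, by positivity, ?_⟩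
  intro j ℓ x k s hj hx hk0 hk hs
  have hL : (0:ℝ) < 2 ^ ℓ := by positivity
  have hk0' : (0:ℝ) < k := by exact_mod_cast hk0
  have key : ‖∫ ξ : ℝ, Complex.exp (Complex.I * ((x.2 * ξ : ℝ) : ℂ)) * g (ξ - s * 2 ^ ℓ) *
        ((2 * Real.pi * conv1 φ₀ (2 ^ ℓ * (x.1 - 2 * ξ / k)) : ℝ) : ℂ)‖ ≤
      (64 * Real.pi * M * ((2:ℝ) ^ ℓ)⁻¹) * G := by
    have i := (gi1.comp_sub_right (s * 2 ^ ℓ)).const_mul (64 * Real.pi * M * ((2:ℝ) ^ ℓ)⁻¹)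
    have := norm_integral_le_of_norm_le i (f := fun ξ : ℝ =>
      Complex.exp (Complex.I * ((x.2 * ξ : ℝ) : ℂ)) * g (ξ - s * 2 ^ ℓ) *
        ((2 * Real.pi * conv1 φ₀ (2 ^ ℓ * (x.1 - 2 * ξ / k)) : ℝ) : ℂ)) ?_
    · refine this.trans (le_of_eq ?_)
      rw [integral_const_mul, integral_sub_right_eq_self (fun ζ => (1 + |ζ|) * ‖g ζ‖)]
    · refine ae_of_all _ fun ξ => ?_
      rw [norm_mul, norm_mul, mul_comm Complex.I, Complex.norm_exp_ofReal_mul_I, one_mul,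
        Complex.norm_real, norm_mul, Real.norm_of_nonneg (by positivity : 0 ≤ 2 * Real.pi)]
      by_cases hz : 1/2 < |2 ^ ℓ * (x.1 - 2 * ξ / k)|
      · rw [conv1_eq_zero φ₀ hsupp _ hz]
        simp only [norm_zero, mul_zero]
        positivity
      · have h32 := aux_freq j ℓ hj x.1 k s ξ hx.1 hx.2 hk0' hk hs (not_lt.1 hz)
        have h1 : 1 ≤ 32 * ((2:ℝ) ^ ℓ)⁻¹ * (1 + |ξ - s * 2 ^ ℓ|) := by
          rw [mul_right_comm, ← div_eq_mul_inv, le_div_iff₀ hL]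
          linarith
        have h2 := hM (2 ^ ℓ * (x.1 - 2 * ξ / k))
        calc ‖g (ξ - s * 2 ^ ℓ)‖ * (2 * Real.pi * ‖conv1 φ₀ (2 ^ ℓ * (x.1 - 2 * ξ / k))‖)
            ≤ ‖g (ξ - s * 2 ^ ℓ)‖ * (2 * Real.pi * M) * 1 := by
              rw [mul_one]; gcongr
          _ ≤ ‖g (ξ - s * 2 ^ ℓ)‖ * (2 * Real.pi * M) *
              (32 * ((2:ℝ) ^ ℓ)⁻¹ * (1 + |ξ - s * 2 ^ ℓ|)) := by gcongr
          _ = _ := by ring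
  have hpow : (2:ℝ) ^ ((1 - β) * (ℓ : ℝ)) * ((2:ℝ) ^ ℓ)⁻¹ = ((2:ℝ) ^ (-β)) ^ ℓ := by
    rw [← Real.rpow_natCast (2 ^ (-β)), ← Real.rpow_mul (by norm_num), ← Real.rpow_natCast 2 ℓ,
      ← Real.rpow_neg (by norm_num), ← Real.rpow_add (by norm_num)]
    congr 1; ring
  rw [aux_E φ₀ β ℓ s g k x gi hg hinv, norm_mul, norm_mul, Complex.norm_real,
    Real.norm_of_nonneg (by positivity)]
  have hp0 : 0 ≤ ((2:ℝ) ^ (-β)) ^ ℓ := by positivity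
  calc _ ≤ ‖(2 * Real.pi : ℂ) ^ (-2 : ℤ)‖ * ((2:ℝ) ^ ((1 - β) * (ℓ : ℝ)) *
        ((64 * Real.pi * M * ((2:ℝ) ^ ℓ)⁻¹) * G)) := by gcongr
    _ = ‖(2 * Real.pi : ℂ) ^ (-2 : ℤ)‖ * (64 * Real.pi * M * G) * ((2:ℝ) ^ (-β)) ^ ℓ := by
        rw [← hpow]; ring
    _ ≤ _ := by rw [add_mul]; linarith

/-- upper bound for the non-resonant pieces in the proof of
Theorem 1.4. Let `β ∈ (1/2, 1)` and `0 < ε < min(1/4, 1-β)`. There is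
`C₂ = C₂(φ₀, β, ε)` such that for every `j ≥ 2`, every `x` with `x₁ ∈ [1/16, 1/4]`,
`x₂ ∈ [-1/16, 1/16]`, and every positive integer `k` with `|k - 2^{j+1}/x₁| ≤ 1/2`,
the series `Σ_{ℓ≥2, ℓ≠j} (e^{i(1/k)□}V_ℓ^+(x) + e^{i(1/k)□}V_ℓ^-(x))` converges
absolutely and
`|Σ_{ℓ≥2, ℓ≠j} (e^{i(1/k)□}V_ℓ^+(x) + e^{i(1/k)□}V_ℓ^-(x)) + e^{i(1/k)□}V_j^-(x)|
  ≤ C₂ 2^{εj}`. -/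
theorem stmt18 (φ₀ : ℝ → ℝ) (hsm : ContDiff ℝ (⊤ : ℕ∞) φ₀)
    (hnonneg : ∀ x, 0 ≤ φ₀ x) (hne : ∃ x, φ₀ x ≠ 0)
    (hsupp : ∀ x : ℝ, x ∉ Set.Icc (-(1/4) : ℝ) (1/4) → φ₀ x = 0)
    (β ε : ℝ) (hβ : 1/2 < β) (hβ' : β < 1)
    (hε : 0 < ε) (hε' : ε < min (1/4) (1 - β)) :
    ∃ C₂ : ℝ, 0 < C₂ ∧
      ∀ j : ℕ, 2 ≤ j →
        ∀ x : ℝ × ℝ, x.1 ∈ Set.Icc (1/16 : ℝ) (1/4) →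
          x.2 ∈ Set.Icc (-(1/16) : ℝ) (1/16) →
          ∀ k : ℕ, 0 < k → |(k : ℝ) - 2 ^ (j + 1) / x.1| ≤ 1/2 →
            Summable (fun ℓ : ℕ =>
              ‖if 2 ≤ ℓ ∧ ℓ ≠ j then Eprop φ₀ β ℓ 1 k x + Eprop φ₀ β ℓ (-1) k x
                else 0‖) ∧
            ‖(∑' ℓ : ℕ,
                if 2 ≤ ℓ ∧ ℓ ≠ j then Eprop φ₀ β ℓ 1 k x + Eprop φ₀ β ℓ (-1) k x
                else 0) + Eprop φ₀ β j (-1) k x‖ ≤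
              C₂ * (2 : ℝ) ^ (ε * (j : ℝ)) := by
  obtain ⟨C, hC, hb⟩ := aux_bound φ₀ hsm hsupp β
  have hr0 : (0:ℝ) ≤ 2 ^ (-β) := by positivity
  have hr1 : (2:ℝ) ^ (-β) < 1 := Real.rpow_lt_one_of_one_lt_of_neg (by norm_num) (by linarith)
  have hgeo := (hasSum_geometric_of_lt_one hr0 hr1).mul_left (2 * C)
  have hi : (0:ℝ) ≤ (1 - (2:ℝ) ^ (-β))⁻¹ := inv_nonneg.2 (by linarith)
  refine ⟨2 * C * (1 - (2:ℝ) ^ (-β))⁻¹ + C, by positivity, ?_⟩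
  intro j hj x hx1 hx2 k hk0 hk
  have hterm : ∀ ℓ : ℕ, ‖if 2 ≤ ℓ ∧ ℓ ≠ j then Eprop φ₀ β ℓ 1 k x + Eprop φ₀ β ℓ (-1) k x
      else 0‖ ≤ 2 * C * ((2:ℝ) ^ (-β)) ^ ℓ := by
    intro ℓ
    split_ifs with h
    · have h1 := hb j ℓ x k 1 hj hx1 hk0 hk (Or.inl ⟨rfl, h.2⟩)
      have h2 := hb j ℓ x k (-1) hj hx1 hk0 hk (Or.inr rfl)
      refine (norm_add_le _ _).trans ?_
      linarith
    · rw [norm_zero]; positivity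
  refine ⟨Summable.of_nonneg_of_le (fun _ => norm_nonneg _) hterm hgeo.summable, ?_⟩
  have h1 := tsum_of_norm_bounded hgeo hterm
  have h2 := hb j j x k (-1) hj hx1 hk0 hk (Or.inr rfl)
  have h3 : ((2:ℝ) ^ (-β)) ^ j ≤ 1 := pow_le_one₀ hr0 hr1.le
  have h4 : (1:ℝ) ≤ (2:ℝ) ^ (ε * (j : ℝ)) :=
    Real.one_le_rpow (by norm_num) (by positivity)
  have h5 : C * ((2:ℝ) ^ (-β)) ^ j ≤ C := by nlinarith
  refine (norm_add_le _ _).trans ?_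
  refine (show _ ≤ 2 * C * (1 - (2:ℝ) ^ (-β))⁻¹ + C by linarith).trans ?_
  exact le_mul_of_one_le_right (by positivity) h4

end
end
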